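/- If (G,(s_1,t_1),(s_2,t_2)) contains a subgraph which is a Bad Configuration, then there exists a nonnegative cost function c (taking value +∞, or equivalently a sufficiently large finite value, outside the Bad Configuration) for which the optimal Steiner forest is unique and not enforceable; consequently (G,(s_1,t_1),(s_2,t_2)) is neither efficient nor strongly efficient. -/

import Mathlib

namespace NDG

variable {V : Type*} [DecidableEq V]

/-- Total cost of a finite set of edges. -/
def cost (c : Sym2 V → ℝ) (F : Finset (Sym2 V)) : ℝ := ∑ e ∈ F, c e

/-- A Steiner forest: an acyclic set of edges of `G` connecting both
terminal pairs. -/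
def IsSteinerForest (G : SimpleGraph V) (s₁ t₁ s₂ t₂ : V) (F : Finset (Sym2 V)) : Prop :=
  (↑F ⊆ G.edgeSet) ∧
  (SimpleGraph.fromEdgeSet (↑F : Set (Sym2 V))).IsAcyclic ∧
  (∃ p : G.Walk s₁ t₁, p.IsPath ∧ ∀ e ∈ p.edges, e ∈ F) ∧
  (∃ p : G.Walk s₂ t₂, p.IsPath ∧ ∀ e ∈ p.edges, e ∈ F)

/-- An optimal Steiner forest: one of minimum total cost. -/
def IsOptimalSteinerForest (G : SimpleGraph V) (s₁ t₁ s₂ t₂ : V) (c : Sym2 V → ℝ)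
    (F : Finset (Sym2 V)) : Prop :=
  IsSteinerForest G s₁ t₁ s₂ t₂ F ∧
  ∀ F', IsSteinerForest G s₁ t₁ s₂ t₂ F' → cost c F ≤ cost c F'

/-- A strategy of a player: a simple path between her terminals. -/
abbrev Strat (G : SimpleGraph V) (s t : V) := {p : G.Walk s t // p.IsPath}

/-- A cost sharing protocol: cost shares for both players on every edge,
depending on the chosen strategy profile. -/
abbrev Protocol (G : SimpleGraph V) (s₁ t₁ s₂ t₂ : V) :=
  Strat G s₁ t₁ → Strat G s₂ t₂ → Fin 2 → Sym2 V → ℝ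

/-- The set of players using edge `e` in the profile `(P₁, P₂)`. -/
def usedBy {G : SimpleGraph V} {s₁ t₁ s₂ t₂ : V}
    (P₁ : Strat G s₁ t₁) (P₂ : Strat G s₂ t₂) (e : Sym2 V) : Finset (Fin 2) :=
  (if e ∈ P₁.1.edges then {0} else ∅) ∪ (if e ∈ P₂.1.edges then {1} else ∅)

/-- The total cost player 1 pays. -/
def cost₁ {G : SimpleGraph V} {s₁ t₁ s₂ t₂ : V} (Ξ : Protocol G s₁ t₁ s₂ t₂)
    (P₁ : Strat G s₁ t₁) (P₂ : Strat G s₂ t₂) : ℝ :=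
  ∑ e ∈ P₁.1.edges.toFinset, Ξ P₁ P₂ 0 e

/-- The total cost player 2 pays. -/
def cost₂ {G : SimpleGraph V} {s₁ t₁ s₂ t₂ : V} (Ξ : Protocol G s₁ t₁ s₂ t₂)
    (P₁ : Strat G s₁ t₁) (P₂ : Strat G s₂ t₂) : ℝ :=
  ∑ e ∈ P₂.1.edges.toFinset, Ξ P₁ P₂ 1 e

/-- Pure Nash equilibrium of the two-player game induced by the protocol `Ξ`. -/
def IsPNE {G : SimpleGraph V} {s₁ t₁ s₂ t₂ : V} (Ξ : Protocol G s₁ t₁ s₂ t₂)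
    (P₁ : Strat G s₁ t₁) (P₂ : Strat G s₂ t₂) : Prop :=
  (∀ Q₁, cost₁ Ξ P₁ P₂ ≤ cost₁ Ξ Q₁ P₂) ∧ (∀ Q₂, cost₂ Ξ P₁ P₂ ≤ cost₂ Ξ P₁ Q₂)

/-- A separable cost sharing protocol: nonnegative, budget-balanced, stable and
separable (cost shares on an edge depend only on the set of players using it). -/
structure IsSeparable {G : SimpleGraph V} {s₁ t₁ s₂ t₂ : V} (c : Sym2 V → ℝ)
    (Ξ : Protocol G s₁ t₁ s₂ t₂) : Prop where
  nonneg : ∀ P₁ P₂ i e, 0 ≤ Ξ P₁ P₂ i e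
  budget : ∀ P₁ P₂ e, (usedBy P₁ P₂ e).Nonempty →
    ∑ i ∈ usedBy P₁ P₂ e, Ξ P₁ P₂ i e = c e
  stable : ∃ P₁ P₂, IsPNE Ξ P₁ P₂
  separable : ∀ P₁ P₂ Q₁ Q₂ e, usedBy P₁ P₂ e = usedBy Q₁ Q₂ e →
    ∀ i, Ξ P₁ P₂ i e = Ξ Q₁ Q₂ i e

/-- A Steiner forest `F` is enforceable if the profile of the unique paths of
the two players inside `F` is a pure Nash equilibrium of the game induced by
some separable cost sharing protocol. -/
def Enforceable (G : SimpleGraph V) (s₁ t₁ s₂ t₂ : V) (c : Sym2 V → ℝ)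
    (F : Finset (Sym2 V)) : Prop :=
  ∃ (P₁ : Strat G s₁ t₁) (P₂ : Strat G s₂ t₂),
    (∀ e ∈ P₁.1.edges, e ∈ F) ∧ (∀ e ∈ P₂.1.edges, e ∈ F) ∧
    (∀ Q₁ : Strat G s₁ t₁, (∀ e ∈ Q₁.1.edges, e ∈ F) → Q₁ = P₁) ∧
    (∀ Q₂ : Strat G s₂ t₂, (∀ e ∈ Q₂.1.edges, e ∈ F) → Q₂ = P₂) ∧
    ∃ Ξ : Protocol G s₁ t₁ s₂ t₂, IsSeparable c Ξ ∧ IsPNE Ξ P₁ P₂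

/-- `(G,(s₁,t₁),(s₂,t₂))` is efficient: for every nonnegative cost function
some optimal Steiner forest is enforceable (the PoS is 1). -/
def Efficient (G : SimpleGraph V) (s₁ t₁ s₂ t₂ : V) : Prop :=
  ∀ c : Sym2 V → ℝ, (∀ e, 0 ≤ c e) →
    ∃ F, IsOptimalSteinerForest G s₁ t₁ s₂ t₂ c F ∧ Enforceable G s₁ t₁ s₂ t₂ c F

/-- `(G,(s₁,t₁),(s₂,t₂))` is strongly efficient: for every nonnegative cost
function every optimal Steiner forest is enforceable. -/
def StronglyEfficient (G : SimpleGraph V) (s₁ t₁ s₂ t₂ : V) : Prop :=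
  ∀ c : Sym2 V → ℝ, (∀ e, 0 ≤ c e) →
    ∀ F, IsOptimalSteinerForest G s₁ t₁ s₂ t₂ c F → Enforceable G s₁ t₁ s₂ t₂ c F

/-- A preliminary bad configuration (PBC) for the terminal pairs `(u,v)` and
`(w,x)`: the path `P_u = Lu ++ M ++ Ru` of one player and the path
`P_ℓ = Ll ++ M ++ Rl` of the other player meet exactly in the nonempty,
consistently oriented common subpath `M`; `q₁` closes a unique cycle with `P_u`
(intersecting it in the segment `S1`, which contains edges of `R_u` and of `M`),
`q₂` and `q₃` close unique cycles with `P_ℓ` (intersecting it in the segments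
`S2` resp. `S3`, containing edges of `L_ℓ` resp. `R_ℓ` and of `M`, and missing
part of `M`); moreover `C := C₂ ∩ C₃ ∩ M` is nonempty and contained in `C₁`, and
`(M ∩ C₁ ∩ C₂) \ C` and `(M ∩ C₁ ∩ C₃) \ C` each contain an edge. -/
structure PBC (G : SimpleGraph V) (u v w x : V) where
  a : V
  b : V
  Lu : G.Walk u a
  M : G.Walk a b
  Ru : G.Walk b v
  Ll : G.Walk w a
  Rl : G.Walk b x
  hM_ne : M.edges ≠ []
  hPu : ((Lu.append M).append Ru).IsPath
  hPl : ((Ll.append M).append Rl).IsPath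
  hforest : (SimpleGraph.fromEdgeSet
      {e | e ∈ ((Lu.append M).append Ru).edges ∨ e ∈ ((Ll.append M).append Rl).edges}).IsAcyclic
  hmeet : ∀ e, e ∈ ((Lu.append M).append Ru).edges →
      e ∈ ((Ll.append M).append Rl).edges → e ∈ M.edges
  hRu_ne : Ru.edges ≠ []
  hLl_ne : Ll.edges ≠ []
  hRl_ne : Rl.edges ≠ []
  a1 : V
  b1 : V
  q1 : G.Walk a1 b1
  S1 : G.Walk a1 b1
  hq1path : q1.IsPath
  hq1_ne : q1.edges ≠ []
  hS1 : S1.darts <:+: ((Lu.append M).append Ru).darts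
  hq1closes : ∀ y ∈ q1.support, y ∈ ((Lu.append M).append Ru).support → y = a1 ∨ y = b1
  hC1Ru : ∃ e ∈ S1.edges, e ∈ Ru.edges
  hC1M : ∃ e ∈ S1.edges, e ∈ M.edges
  a2 : V
  b2 : V
  q2 : G.Walk a2 b2
  S2 : G.Walk a2 b2
  hq2path : q2.IsPath
  hq2_ne : q2.edges ≠ []
  hS2 : S2.darts <:+: ((Ll.append M).append Rl).darts
  hq2closes : ∀ y ∈ q2.support, y ∈ ((Ll.append M).append Rl).support → y = a2 ∨ y = b2
  hC2Ll : ∃ e ∈ S2.edges, e ∈ Ll.edges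
  hC2M : ∃ e ∈ S2.edges, e ∈ M.edges
  hMC2 : ∃ e ∈ M.edges, e ∉ S2.edges
  a3 : V
  b3 : V
  q3 : G.Walk a3 b3
  S3 : G.Walk a3 b3
  hq3path : q3.IsPath
  hq3_ne : q3.edges ≠ []
  hS3 : S3.darts <:+: ((Ll.append M).append Rl).darts
  hq3closes : ∀ y ∈ q3.support, y ∈ ((Ll.append M).append Rl).support → y = a3 ∨ y = b3
  hC3Rl : ∃ e ∈ S3.edges, e ∈ Rl.edges
  hC3M : ∃ e ∈ S3.edges, e ∈ M.edges
  hMC3 : ∃ e ∈ M.edges, e ∉ S3.edges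
  hC_ne : ∃ e ∈ M.edges, e ∈ S2.edges ∧ e ∈ S3.edges
  hC_sub : ∀ e ∈ M.edges, e ∈ S2.edges → e ∈ S3.edges → e ∈ S1.edges
  hC1C2 : ∃ e ∈ M.edges, e ∈ S1.edges ∧ e ∈ S2.edges ∧ e ∉ S3.edges
  hC1C3 : ∃ e ∈ M.edges, e ∈ S1.edges ∧ e ∈ S3.edges ∧ e ∉ S2.edges

namespace PBC

variable {G : SimpleGraph V} {u v w x : V}

/-- The path of the "upper" player (terminals `u`, `v`). -/
def Pu (B : PBC G u v w x) : G.Walk u v := (B.Lu.append B.M).append B.Ru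

/-- The path of the "lower" player (terminals `w`, `x`). -/
def Pl (B : PBC G u v w x) : G.Walk w x := (B.Ll.append B.M).append B.Rl

/-- `q₁` is small: the cycle `C₁` contains no edge of `L_u`. -/
def Small (B : PBC G u v w x) : Prop := ∀ e ∈ B.S1.edges, e ∉ B.Lu.edges

/-- `q₁` is big: the cycle `C₁` contains an edge of `L_u`. -/
def Big (B : PBC G u v w x) : Prop := ∃ e ∈ B.S1.edges, e ∈ B.Lu.edges

/-- Node-disjointness of two walks. -/
def NodeDisj {y z y' z' : V} (p : G.Walk y z) (q : G.Walk y' z') : Prop :=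
  ∀ s ∈ p.support, s ∉ q.support

/-- `q` is internally node-disjoint from `P_u ∪ P_ℓ`. -/
def InternDisj (B : PBC G u v w x) {y z : V} (q : G.Walk y z) : Prop :=
  ∀ s ∈ q.support, s ≠ y → s ≠ z → s ∉ B.Pu.support ∧ s ∉ B.Pl.support

/-- The two walks intersect exactly in a common (possibly reversed) subpath. -/
def CommonMid {y z y' z' : V} (p : G.Walk y z) (q : G.Walk y' z') : Prop :=
  ∃ (c d : V) (m : G.Walk c d), m.IsPath ∧
    m.darts <:+: p.darts ∧ (m.darts <:+: q.darts ∨ m.reverse.darts <:+: q.darts) ∧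
    ∀ s, s ∈ p.support → s ∈ q.support → s ∈ m.support

/-- `q` contains no node of `L_u` or `R_u`. -/
def AvoidsUpperOuter (B : PBC G u v w x) {y z : V} (q : G.Walk y z) : Prop :=
  ∀ s ∈ q.support, s ∉ B.Lu.support ∧ s ∉ B.Ru.support

/-- In BC3/BC4, `q₁` avoids `R_ℓ` and the start node of `q₂`, and its initial
segment `α₁` (up to the last node contained in `L_ℓ`) runs inside the cycle
`C₂` along `L_ℓ`. -/
def LlTraverse (B : PBC G u v w x) : Prop :=
  (∀ s ∈ B.q1.support, s ∉ B.Rl.support) ∧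
  B.a2 ∉ B.q1.support ∧
  ∃ (y : V) (α : G.Walk B.a1 y) (β : G.Walk y B.b1),
    B.q1 = α.append β ∧ y ∈ B.Ll.support ∧
    (∀ e ∈ α.edges, e ∈ B.S2.edges) ∧
    (∀ s ∈ β.support, s ∈ B.Ll.support → s = y)

/-- Types BC1a (`q₁` small) and BC1b (`q₁` big): `q₁,q₂,q₃` pairwise
node-disjoint and internally node-disjoint from `P_u ∪ P_ℓ`. -/
def BC1 (B : PBC G u v w x) : Prop :=
  NodeDisj B.q1 B.q2 ∧ NodeDisj B.q1 B.q3 ∧ NodeDisj B.q2 B.q3 ∧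
  B.InternDisj B.q1 ∧ B.InternDisj B.q2 ∧ B.InternDisj B.q3

/-- Types BC2a–d: `q₃` node-disjoint with `q₁` and `q₂`; `q₁` and `q₂` overlap
exactly in a common subpath (`α₂ = β₂`); everything internally node-disjoint
from `P_u ∪ P_ℓ` (the subtypes corresponding to `q₁` small/big and the two
orientations of the common subpath are subsumed). -/
def BC2 (B : PBC G u v w x) : Prop :=
  NodeDisj B.q3 B.q1 ∧ NodeDisj B.q3 B.q2 ∧
  ¬ NodeDisj B.q1 B.q2 ∧ CommonMid B.q1 B.q2 ∧
  B.InternDisj B.q1 ∧ B.InternDisj B.q2 ∧ B.InternDisj B.q3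

/-- Type BC3. -/
def BC3 (B : PBC G u v w x) : Prop :=
  B.Small ∧ (∀ e ∈ B.M.edges, e ∈ B.S1.edges) ∧
  NodeDisj B.q1 B.q2 ∧ NodeDisj B.q1 B.q3 ∧ NodeDisj B.q2 B.q3 ∧
  B.AvoidsUpperOuter B.q2 ∧ B.AvoidsUpperOuter B.q3 ∧
  B.LlTraverse

/-- Types BC4a/b. -/
def BC4 (B : PBC G u v w x) : Prop :=
  B.Small ∧ (∀ e ∈ B.M.edges, e ∈ B.S1.edges) ∧
  NodeDisj B.q3 B.q1 ∧ NodeDisj B.q3 B.q2 ∧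
  ¬ NodeDisj B.q1 B.q2 ∧ CommonMid B.q1 B.q2 ∧
  B.AvoidsUpperOuter B.q2 ∧ B.AvoidsUpperOuter B.q3 ∧
  B.LlTraverse

/-- A PBC is a bad configuration if it is of one of the nine types
BC1a, BC1b, BC2a, BC2b, BC2c, BC2d, BC3, BC4a, BC4b. -/
def IsBC (B : PBC G u v w x) : Prop := B.BC1 ∨ B.BC2 ∨ B.BC3 ∨ B.BC4

end PBC

/-- `(G,(s₁,t₁),(s₂,t₂))` contains a subgraph which is a bad configuration,
for some assignment of the terminal pairs to `(u,v)` and `(w,x)`. -/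
def ContainsBC (G : SimpleGraph V) (s₁ t₁ s₂ t₂ : V) : Prop :=
  (∃ B : PBC G s₁ t₁ s₂ t₂, B.IsBC) ∨ (∃ B : PBC G s₁ t₁ t₂ s₂, B.IsBC) ∨
  (∃ B : PBC G t₁ s₁ s₂ t₂, B.IsBC) ∨ (∃ B : PBC G t₁ s₁ t₂ s₂, B.IsBC) ∨
  (∃ B : PBC G s₂ t₂ s₁ t₁, B.IsBC) ∨ (∃ B : PBC G s₂ t₂ t₁ s₁, B.IsBC) ∨
  (∃ B : PBC G t₂ s₂ s₁ t₁, B.IsBC) ∨ (∃ B : PBC G t₂ s₂ t₁ s₁, B.IsBC)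




set_option linter.unusedSectionVars false

/-! ### Walk lemmas -/

lemma mem_edges_iff {G : SimpleGraph V} {u v : V} (p : G.Walk u v) (e : Sym2 V) :
    e ∈ p.edges ↔ ∃ i, i < p.length ∧ e = s(p.getVert i, p.getVert (i + 1)) := by
  rw [List.mem_iff_getElem]
  constructor
  · rintro ⟨i, hi, rfl⟩
    exact ⟨i, by simpa using hi, SimpleGraph.Walk.getElem_edges hi⟩
  · rintro ⟨i, hi, rfl⟩
    exact ⟨i, by simpa using hi, SimpleGraph.Walk.getElem_edges _⟩

lemma mem_support_iff' {G : SimpleGraph V} {u v : V} (p : G.Walk u v) (y : V) :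
    y ∈ p.support ↔ ∃ i, i ≤ p.length ∧ p.getVert i = y := by
  rw [SimpleGraph.Walk.mem_support_iff_exists_getVert]
  constructor
  · rintro ⟨i, h, h'⟩; exact ⟨i, h', h⟩
  · rintro ⟨i, h, h'⟩; exact ⟨i, h', h⟩

lemma segment_pos {G : SimpleGraph V} {u v a b : V} (P : G.Walk u v) (S : G.Walk a b)
    (h : S.darts <:+: P.darts) (hne : S.edges ≠ []) :
    ∃ k, k + S.length ≤ P.length ∧ P.getVert k = a ∧ P.getVert (k + S.length) = b ∧
      ∀ e, e ∈ S.edges ↔ ∃ i, k ≤ i ∧ i < k + S.length ∧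
        e = s(P.getVert i, P.getVert (i + 1)) := by
  obtain ⟨l₁, l₂, h⟩ := h
  have hlen : l₁.length + S.length + l₂.length = P.length := by
    have := congrArg List.length h
    simp only [List.length_append, SimpleGraph.Walk.length_darts] at this
    exact this
  have hpos : 0 < S.length := by
    rcases Nat.eq_zero_or_pos S.length with h0 | h0
    · exfalso; apply hne
      apply List.eq_nil_of_length_eq_zero
      simpa using h0
    · exact h0
  have key : ∀ i, i < S.length → S.getVert i = P.getVert (l₁.length + i) ∧
      S.getVert (i + 1) = P.getVert (l₁.length + i + 1) := by
    intro i hi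
    have h1 : i < S.darts.length := by simpa using hi
    have h2 : l₁.length + i < P.darts.length := by
      rw [SimpleGraph.Walk.length_darts]; omega
    have e1 : P.darts[l₁.length + i] = S.darts[i] := by
      have : (l₁ ++ S.darts ++ l₂)[l₁.length + i]'(by rw [h]; exact h2) = S.darts[i] := by
        rw [List.getElem_append_left (by simp; exact hi)]
        rw [List.getElem_append_right (by omega)]
        simp
      rw [← this]
      congr 1
      exact h.symm
    rw [SimpleGraph.Walk.darts_getElem_eq_getVert, SimpleGraph.Walk.darts_getElem_eq_getVert] at e1
    have e2 := congrArg (fun d => d.toProd.1) e1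
    have e3 := congrArg (fun d => d.toProd.2) e1
    exact ⟨e2.symm, e3.symm⟩
  refine ⟨l₁.length, by omega, ?_, ?_, ?_⟩
  · have := (key 0 hpos).1
    simpa using this.symm
  · have := (key (S.length - 1) (by omega)).2
    rw [show S.length - 1 + 1 = S.length by omega, SimpleGraph.Walk.getVert_length] at this
    rw [show l₁.length + (S.length - 1) + 1 = l₁.length + S.length by omega] at this
    exact this.symm
  · intro e
    rw [mem_edges_iff]
    constructor
    · rintro ⟨i, hi, rfl⟩
      refine ⟨l₁.length + i, by omega, by omega, ?_⟩
      rw [(key i hi).1, (key i hi).2]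
    · rintro ⟨i, h1, h2, rfl⟩
      refine ⟨i - l₁.length, by omega, ?_⟩
      have := key (i - l₁.length) (by omega)
      rw [this.1, this.2, show l₁.length + (i - l₁.length) = i by omega]

lemma take_edges {G : SimpleGraph V} {u v : V} (P : G.Walk u v) (k : ℕ) (e : Sym2 V)
    (h : e ∈ (P.take k).edges) :
    ∃ i, i < k ∧ i < P.length ∧ e = s(P.getVert i, P.getVert (i + 1)) := by
  rw [mem_edges_iff] at h
  obtain ⟨i, hi, rfl⟩ := h
  rw [SimpleGraph.Walk.take_length] at hi
  refine ⟨i, by omega, by omega, ?_⟩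
  rw [SimpleGraph.Walk.take_getVert, SimpleGraph.Walk.take_getVert,
    show k ⊓ i = i by omega, show k ⊓ (i + 1) = i + 1 by omega]

lemma drop_edges {G : SimpleGraph V} {u v : V} (P : G.Walk u v) (k : ℕ) (e : Sym2 V)
    (h : e ∈ (P.drop k).edges) :
    ∃ i, k ≤ i ∧ i < P.length ∧ e = s(P.getVert i, P.getVert (i + 1)) := by
  rw [mem_edges_iff] at h
  obtain ⟨i, hi, rfl⟩ := h
  rw [SimpleGraph.Walk.drop_length] at hi
  refine ⟨k + i, by omega, by omega, ?_⟩
  rw [SimpleGraph.Walk.drop_getVert, SimpleGraph.Walk.drop_getVert]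
  rfl

/-- Segments of a path. -/
lemma seg_exists {G : SimpleGraph V} {u v : V} (P : G.Walk u v) (hP : P.IsPath) (i j : ℕ)
    (hij : i ≤ j) (hj : j ≤ P.length) :
    ∃ p : G.Walk (P.getVert i) (P.getVert j), p.IsPath ∧
      ∀ e, e ∈ p.edges ↔ ∃ t, i ≤ t ∧ t < j ∧ e = s(P.getVert t, P.getVert (t + 1)) := by
  have h1 : (P.take j).getVert i = P.getVert i := by
    rw [SimpleGraph.Walk.take_getVert]; congr 1; omega
  refine ⟨((P.take j).drop i).copy h1 rfl, ?_, ?_⟩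
  · rw [SimpleGraph.Walk.isPath_copy]
    exact (hP.take j).drop i
  · intro e
    rw [SimpleGraph.Walk.edges_copy, mem_edges_iff]
    simp only [SimpleGraph.Walk.drop_length, SimpleGraph.Walk.take_length,
      SimpleGraph.Walk.drop_getVert, SimpleGraph.Walk.take_getVert]
    constructor
    · rintro ⟨t, ht, rfl⟩
      refine ⟨i + t, by omega, by omega, ?_⟩
      rw [show j ⊓ (i + t) = i + t by omega, show j ⊓ (i + (t + 1)) = i + t + 1 by omega]
    · rintro ⟨t, h1, h2, rfl⟩
      refine ⟨t - i, by omega, ?_⟩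
      rw [show j ⊓ (i + (t - i)) = t by omega, show j ⊓ (i + (t - i + 1)) = t + 1 by omega]

lemma path_unique_of_acyclic {G : SimpleGraph V} {S : Set (Sym2 V)}
    (hS : (SimpleGraph.fromEdgeSet S).IsAcyclic) {u v : V} (p q : G.Walk u v)
    (hp : p.IsPath) (hq : q.IsPath) (hpS : ∀ e ∈ p.edges, e ∈ S) (hqS : ∀ e ∈ q.edges, e ∈ S) :
    p = q := by
  have aux : ∀ r : G.Walk u v, (∀ e ∈ r.edges, e ∈ S) →
      ∀ e ∈ r.edges, e ∈ (SimpleGraph.fromEdgeSet S).edgeSet := by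
    intro r hr e he
    rw [SimpleGraph.edgeSet_fromEdgeSet]
    exact ⟨hr e he, fun h => G.not_isDiag_of_mem_edgeSet (r.edges_subset_edgeSet he) h⟩
  have := (hS.subsingleton_path u v).elim ⟨p.transfer _ (aux p hpS), hp.transfer _⟩
    ⟨q.transfer _ (aux q hqS), hq.transfer _⟩
  have h2 := congrArg (fun r => r.1.support) this
  simp only [SimpleGraph.Walk.support_transfer] at h2
  exact SimpleGraph.Walk.ext_support h2

/-- A walk from `y` to `z` avoiding a cut does not exist. -/
lemma walk_cross {G : SimpleGraph V} (σ : V → Bool) {u v : V} (p : G.Walk u v)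
    (h : σ u ≠ σ v) : ∃ y z, s(y, z) ∈ p.edges ∧ σ y ≠ σ z := by
  induction p with
  | nil => exact absurd rfl h
  | @cons a b c hab p ih =>
    by_cases h1 : σ a = σ b
    · obtain ⟨y, z, h2, h3⟩ := ih (by rwa [← h1])
      exact ⟨y, z, by simp [h2], h3⟩
    · exact ⟨a, b, by simp, h1⟩


/-! ### The abstract core -/

/-- `E` is the edge set of a simple path between `u` and `v`. -/
def PathSet (G : SimpleGraph V) (u v : V) (E : Finset (Sym2 V)) : Prop :=
  ∃ p : G.Walk u v, p.IsPath ∧ p.edges.toFinset = E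

lemma PathSet.symm {G : SimpleGraph V} {u v : V} {E : Finset (Sym2 V)} (h : PathSet G u v E) :
    PathSet G v u E := by
  obtain ⟨p, hp, rfl⟩ := h
  exact ⟨p.reverse, hp.reverse, by ext e; simp⟩

/-- Orientation free data from which the theorem follows. -/
structure Core (G : SimpleGraph V) (u v w x : V) (c : Sym2 V → ℝ)
    (EU EL E1 E2 E3 : Finset (Sym2 V)) : Prop where
  nn : ∀ e, 0 ≤ c e
  hU : PathSet G u v EU
  hL : PathSet G w x EL
  h1 : PathSet G u v E1
  h2 : PathSet G w x E2
  h3 : PathSet G w x E3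
  acyc : (SimpleGraph.fromEdgeSet (↑(EU ∪ EL) : Set (Sym2 V))).IsAcyclic
  opt : ∀ F' D1 D2, PathSet G u v D1 → PathSet G w x D2 → D1 ⊆ F' → D2 ⊆ F' →
    cost c F' ≤ cost c (EU ∪ EL) → F' = EU ∪ EL
  noshare : ∀ s t : Sym2 V → ℝ, (∀ e, 0 ≤ s e) → (∀ e, 0 ≤ t e) →
    (∀ e ∈ EU, e ∉ EL → s e = c e) → (∀ e ∈ EL, e ∉ EU → t e = c e) →
    (∀ e ∈ EU, e ∈ EL → s e + t e = c e) →
    ∑ e ∈ EU \ E1, s e ≤ ∑ e ∈ E1 \ EU, c e →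
    ∑ e ∈ EL \ E2, t e ≤ ∑ e ∈ E2 \ EL, c e →
    ∑ e ∈ EL \ E3, t e ≤ ∑ e ∈ E3 \ EL, c e → False

lemma Core.symm1 {G : SimpleGraph V} {u v w x : V} {c : Sym2 V → ℝ}
    {EU EL E1 E2 E3 : Finset (Sym2 V)} (h : Core G u v w x c EU EL E1 E2 E3) :
    Core G v u w x c EU EL E1 E2 E3 where
  nn := h.nn
  hU := h.hU.symm
  hL := h.hL
  h1 := h.h1.symm
  h2 := h.h2
  h3 := h.h3
  acyc := h.acyc
  opt := fun F' D1 D2 a b => h.opt F' D1 D2 a.symm b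
  noshare := h.noshare

lemma Core.symm2 {G : SimpleGraph V} {u v w x : V} {c : Sym2 V → ℝ}
    {EU EL E1 E2 E3 : Finset (Sym2 V)} (h : Core G u v w x c EU EL E1 E2 E3) :
    Core G u v x w c EU EL E1 E2 E3 where
  nn := h.nn
  hU := h.hU
  hL := h.hL.symm
  h1 := h.h1
  h2 := h.h2.symm
  h3 := h.h3.symm
  acyc := h.acyc
  opt := fun F' D1 D2 a b => h.opt F' D1 D2 a b.symm
  noshare := h.noshare

lemma sum_sdiff_le (A B : Finset (Sym2 V)) (s s' c : Sym2 V → ℝ)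
    (h1 : ∀ e ∈ B, e ∈ A → s' e = s e) (h2 : ∀ e ∈ B, s' e ≤ c e)
    (h : ∑ e ∈ A, s e ≤ ∑ e ∈ B, s' e) : ∑ e ∈ A \ B, s e ≤ ∑ e ∈ B \ A, c e := by
  have hA : ∑ e ∈ A \ B, s e + ∑ e ∈ A ∩ B, s e = ∑ e ∈ A, s e := by
    rw [add_comm]; exact Finset.sum_inter_add_sum_sdiff A B s
  have hB : ∑ e ∈ B \ A, s' e + ∑ e ∈ B ∩ A, s' e = ∑ e ∈ B, s' e := by
    rw [add_comm]; exact Finset.sum_inter_add_sum_sdiff B A s'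
  have h3 : ∑ e ∈ B ∩ A, s' e = ∑ e ∈ A ∩ B, s e := by
    rw [Finset.inter_comm B A]
    apply Finset.sum_congr rfl
    intro e he
    rw [Finset.mem_inter] at he
    exact h1 e he.2 he.1
  have h4 : ∑ e ∈ B \ A, s' e ≤ ∑ e ∈ B \ A, c e := by
    apply Finset.sum_le_sum
    intro e he
    exact h2 e (Finset.mem_sdiff.1 he).1
  linarith

/-- What an equilibrium under a separable protocol implies for the shares. -/
lemma pne_shares {G : SimpleGraph V} {s₁ t₁ s₂ t₂ : V} {c : Sym2 V → ℝ}
    {Ξ : Protocol G s₁ t₁ s₂ t₂} (hΞ : IsSeparable c Ξ) {P₁ : Strat G s₁ t₁} {P₂ : Strat G s₂ t₂}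
    (hP : IsPNE Ξ P₁ P₂) :
    (∀ e ∈ P₁.1.edges, e ∉ P₂.1.edges → Ξ P₁ P₂ 0 e = c e) ∧
    (∀ e ∈ P₂.1.edges, e ∉ P₁.1.edges → Ξ P₁ P₂ 1 e = c e) ∧
    (∀ e ∈ P₁.1.edges, e ∈ P₂.1.edges → Ξ P₁ P₂ 0 e + Ξ P₁ P₂ 1 e = c e) ∧
    (∀ E, PathSet G s₁ t₁ E → ∑ e ∈ P₁.1.edges.toFinset \ E, Ξ P₁ P₂ 0 e ≤
      ∑ e ∈ E \ P₁.1.edges.toFinset, c e) ∧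
    (∀ E, PathSet G s₂ t₂ E → ∑ e ∈ P₂.1.edges.toFinset \ E, Ξ P₁ P₂ 1 e ≤
      ∑ e ∈ E \ P₂.1.edges.toFinset, c e) := by
  have b0 : ∀ Q₁ Q₂ e, e ∈ Q₁.1.edges → e ∉ Q₂.1.edges → Ξ Q₁ Q₂ 0 e = c e := by
    intro Q₁ Q₂ e h1 h2
    have := hΞ.budget Q₁ Q₂ e (by simp [usedBy, h1])
    simpa [usedBy, h1, h2] using this
  have b1 : ∀ Q₁ Q₂ e, e ∈ Q₂.1.edges → e ∉ Q₁.1.edges → Ξ Q₁ Q₂ 1 e = c e := by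
    intro Q₁ Q₂ e h1 h2
    have := hΞ.budget Q₁ Q₂ e (by simp [usedBy, h1])
    simpa [usedBy, h1, h2] using this
  have b2 : ∀ Q₁ Q₂ e, e ∈ Q₁.1.edges → e ∈ Q₂.1.edges → Ξ Q₁ Q₂ 0 e + Ξ Q₁ Q₂ 1 e = c e := by
    intro Q₁ Q₂ e h1 h2
    have := hΞ.budget Q₁ Q₂ e (by simp [usedBy, h1])
    have h3 : usedBy Q₁ Q₂ e = {0, 1} := by simp [usedBy, h1, h2]
    rw [h3, Finset.sum_pair (by decide)] at this
    exact this
  refine ⟨b0 P₁ P₂, b1 P₁ P₂, b2 P₁ P₂, ?_, ?_⟩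
  · rintro E ⟨q, hq, rfl⟩
    apply sum_sdiff_le _ _ _ (Ξ ⟨q, hq⟩ P₂ 0)
    · intro e h1 h2
      apply hΞ.separable
      rw [List.mem_toFinset] at h1 h2
      simp [usedBy, h1, h2]
    · intro e h1
      rw [List.mem_toFinset] at h1
      by_cases h2 : e ∈ P₂.1.edges
      · have := b2 ⟨q, hq⟩ P₂ e h1 h2
        have := hΞ.nonneg ⟨q, hq⟩ P₂ 1 e
        linarith
      · exact (b0 ⟨q, hq⟩ P₂ e h1 h2).le
    · exact hP.1 ⟨q, hq⟩
  · rintro E ⟨q, hq, rfl⟩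
    apply sum_sdiff_le _ _ _ (Ξ P₁ ⟨q, hq⟩ 1)
    · intro e h1 h2
      apply hΞ.separable
      rw [List.mem_toFinset] at h1 h2
      simp [usedBy, h1, h2]
    · intro e h1
      rw [List.mem_toFinset] at h1
      by_cases h2 : e ∈ P₁.1.edges
      · have := b2 P₁ ⟨q, hq⟩ e h2 h1
        have := hΞ.nonneg P₁ ⟨q, hq⟩ 0 e
        linarith
      · exact (b1 P₁ ⟨q, hq⟩ e h1 h2).le
    · exact hP.2 ⟨q, hq⟩

/-- The first part of the conclusion of the main theorem. -/
def Concl (G : SimpleGraph V) (s₁ t₁ s₂ t₂ : V) : Prop :=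
  ∃ c : Sym2 V → ℝ, (∀ e, 0 ≤ c e) ∧
      ∃ F, IsOptimalSteinerForest G s₁ t₁ s₂ t₂ c F ∧
        (∀ F', IsOptimalSteinerForest G s₁ t₁ s₂ t₂ c F' → F' = F) ∧
        ¬ Enforceable G s₁ t₁ s₂ t₂ c F

lemma PathSet.sub {G : SimpleGraph V} {u v : V} {E : Finset (Sym2 V)} (h : PathSet G u v E) :
    (↑E : Set (Sym2 V)) ⊆ G.edgeSet := by
  obtain ⟨p, hp, rfl⟩ := h
  intro e he
  exact p.edges_subset_edgeSet (by simpa using he)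

lemma concl_of {G : SimpleGraph V} {s₁ t₁ s₂ t₂ : V} {c : Sym2 V → ℝ}
    {A B : Finset (Sym2 V)} (nn : ∀ e, 0 ≤ c e)
    (hA : PathSet G s₁ t₁ A) (hB : PathSet G s₂ t₂ B)
    (acyc : (SimpleGraph.fromEdgeSet (↑(A ∪ B) : Set (Sym2 V))).IsAcyclic)
    (opt : ∀ F' D1 D2, PathSet G s₁ t₁ D1 → PathSet G s₂ t₂ D2 → D1 ⊆ F' → D2 ⊆ F' →
      cost c F' ≤ cost c (A ∪ B) → F' = A ∪ B)
    (hen : ∀ s t : Sym2 V → ℝ, (∀ e, 0 ≤ s e) → (∀ e, 0 ≤ t e) →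
      (∀ e ∈ A, e ∉ B → s e = c e) → (∀ e ∈ B, e ∉ A → t e = c e) →
      (∀ e ∈ A, e ∈ B → s e + t e = c e) →
      (∀ E, PathSet G s₁ t₁ E → ∑ e ∈ A \ E, s e ≤ ∑ e ∈ E \ A, c e) →
      (∀ E, PathSet G s₂ t₂ E → ∑ e ∈ B \ E, t e ≤ ∑ e ∈ E \ B, c e) → False) :
    Concl G s₁ t₁ s₂ t₂ := by
  have hst : ∀ F', IsSteinerForest G s₁ t₁ s₂ t₂ F' → cost c F' ≤ cost c (A ∪ B) →
      F' = A ∪ B := by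
    rintro F' ⟨_, _, ⟨p, hp, hp'⟩, ⟨q, hq, hq'⟩⟩ h
    exact opt F' _ _ ⟨p, hp, rfl⟩ ⟨q, hq, rfl⟩ (fun e he => hp' e (by simpa using he))
      (fun e he => hq' e (by simpa using he)) h
  have hF : IsSteinerForest G s₁ t₁ s₂ t₂ (A ∪ B) := by
    refine ⟨?_, acyc, ?_, ?_⟩
    · rw [Finset.coe_union]
      exact Set.union_subset hA.sub hB.sub
    · obtain ⟨p, hp, rfl⟩ := hA
      exact ⟨p, hp, fun e he => by simp [he]⟩
    · obtain ⟨p, hp, rfl⟩ := hB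
      exact ⟨p, hp, fun e he => by simp [he]⟩
  refine ⟨c, nn, A ∪ B, ⟨hF, ?_⟩, ?_, ?_⟩
  · intro F' hF'
    by_contra h
    push Not at h
    rw [hst F' hF' h.le] at h
    exact lt_irrefl _ h
  · rintro F' ⟨h1, h2⟩
    exact hst F' h1 (h2 _ hF)
  · rintro ⟨P₁, P₂, -, -, h1, h2, Ξ, hΞ, hP⟩
    have eA : P₁.1.edges.toFinset = A := by
      obtain ⟨p, hp, rfl⟩ := hA
      rw [← h1 ⟨p, hp⟩ (fun e he => by simp [he])]
    have eB : P₂.1.edges.toFinset = B := by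
      obtain ⟨p, hp, rfl⟩ := hB
      rw [← h2 ⟨p, hp⟩ (fun e he => by simp [he])]
    obtain ⟨g1, g2, g3, g4, g5⟩ := pne_shares hΞ hP
    subst eA eB
    simp only [List.mem_toFinset] at hen
    exact hen _ _ (fun e => hΞ.nonneg _ _ _ _) (fun e => hΞ.nonneg _ _ _ _) g1 g2 g3 g4 g5

lemma Core.concl {G : SimpleGraph V} {u v w x : V} {c : Sym2 V → ℝ}
    {EU EL E1 E2 E3 : Finset (Sym2 V)} (h : Core G u v w x c EU EL E1 E2 E3) :
    Concl G u v w x :=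
  concl_of h.nn h.hU h.hL h.acyc h.opt
    (fun s t hs ht a1 a2 a3 a4 a5 => h.noshare s t hs ht a1 a2 a3 (a4 _ h.h1) (a5 _ h.h2) (a5 _ h.h3))

lemma Core.concl' {G : SimpleGraph V} {u v w x : V} {c : Sym2 V → ℝ}
    {EU EL E1 E2 E3 : Finset (Sym2 V)} (h : Core G u v w x c EU EL E1 E2 E3) :
    Concl G w x u v :=
  concl_of h.nn h.hL h.hU (by rw [Finset.union_comm]; exact h.acyc)
    (fun F' D1 D2 a1 a2 a3 a4 a5 => by
      rw [Finset.union_comm EL EU] at a5 ⊢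
      exact h.opt F' D2 D1 a2 a1 a4 a3 a5)
    (fun s t hs ht a1 a2 a3 a4 a5 => h.noshare t s ht hs a2 a1
      (fun e h1 h2 => by rw [add_comm]; exact a3 e h2 h1) (a5 _ h.h1) (a4 _ h.h2) (a4 _ h.h3))


/-! ### The finite optimisation problem -/

/-- First label of the special edges. -/
def src : Fin 11 → ℕ := ![5, 0, 1, 2, 3, 3, 0, 7, 5, 7, 1]

/-- Second label of the special edges. -/
def dst : Fin 11 → ℕ := ![0, 1, 2, 3, 4, 6, 7, 4, 7, 2, 6]

/-- Weights of the special edges. -/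
def wt : Fin 11 → ℕ := ![100, 10, 10, 10, 100, 100, 13, 100, 100, 8, 108]

lemma bool_core : ∀ t0 t1 t2 t3 t4 t5 t6 t7 t8 t9 t10 : Bool,
    ((t5 || t10) && (t4 || t7) && (t0 || t8) && (t0 || t1 || t6) &&
    (t1 || t6 || t8) && (t3 || t4 || t10) && (t3 || t7 || t10) &&
    (t3 || t5 || t7) && (t0 || t2 || t6 || t10) && (t2 || t6 || t8 || t10) &&
    (t1 || t2 || t5) && (t0 || t2 || t5 || t6) && (t2 || t5 || t6 || t8) &&
    (t2 || t4 || t9 || t10) && (t2 || t7 || t9 || t10) &&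
    (t0 || t3 || t5 || t6 || t9) && (t3 || t5 || t6 || t8 || t9)) = true →
    330 ≤ (bif t0 then 100 else 0) + (bif t1 then 10 else 0) + (bif t2 then 10 else 0) +
      (bif t3 then 10 else 0) + (bif t4 then 100 else 0) + (bif t5 then 100 else 0) +
      (bif t6 then 13 else 0) + (bif t7 then 100 else 0) + (bif t8 then 100 else 0) +
      (bif t9 then 8 else 0) + (bif t10 then 108 else 0) := by
  decide +kernel

/-- The cut given by a list of labels. -/
def cutOf (l : List ℕ) (n : ℕ) : Bool := decide (n ∈ l)

lemma fin_core (T : Fin 11 → Bool)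
    (h : ∀ σ : ℕ → Bool, (σ 0 ≠ σ 4 ∨ σ 5 ≠ σ 6) → ∃ i, T i = true ∧ σ (src i) ≠ σ (dst i)) :
    330 ≤ ∑ i, if T i = true then wt i else 0 := by
  have h1 := h (cutOf [6]) (by decide)
  have h2 := h (cutOf [4]) (by decide)
  have h3 := h (cutOf [5]) (by decide)
  have h4 := h (cutOf [0]) (by decide)
  have h5 := h (cutOf [0, 5]) (by decide)
  have h6 := h (cutOf [3, 6]) (by decide)
  have h7 := h (cutOf [3, 4, 6]) (by decide)
  have h8 := h (cutOf [3, 4]) (by decide)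
  have h9 := h (cutOf [0, 1]) (by decide)
  have h10 := h (cutOf [0, 1, 5]) (by decide)
  have h11 := h (cutOf [1, 6]) (by decide)
  have h12 := h (cutOf [0, 1, 6]) (by decide)
  have h13 := h (cutOf [0, 1, 5, 6]) (by decide)
  have h14 := h (cutOf [2, 3, 6]) (by decide)
  have h15 := h (cutOf [2, 3, 4, 6]) (by decide)
  have h16 := h (cutOf [0, 1, 2, 6]) (by decide)
  have h17 := h (cutOf [0, 1, 2, 5, 6]) (by decide)
  clear h
  have key := bool_core (T 0) (T 1) (T 2) (T 3) (T 4) (T 5) (T 6) (T 7) (T 8) (T 9) (T 10)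
  have e0 : (∑ i, if T i = true then wt i else 0) =
      (bif T 0 then 100 else 0) + (bif T 1 then 10 else 0) + (bif T 2 then 10 else 0) +
      (bif T 3 then 10 else 0) + (bif T 4 then 100 else 0) + (bif T 5 then 100 else 0) +
      (bif T 6 then 13 else 0) + (bif T 7 then 100 else 0) + (bif T 8 then 100 else 0) +
      (bif T 9 then 8 else 0) + (bif T 10 then 108 else 0) := by
    simp only [Bool.cond_eq_ite]
    simp only [Fin.sum_univ_succ, wt]
    simp
    simp [add_assoc]
  rw [e0]
  have conv : ∀ l : List ℕ, (∃ i, T i = true ∧ cutOf l (src i) ≠ cutOf l (dst i)) →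
      (List.finRange 11).any (fun i => (cutOf l (src i) != cutOf l (dst i)) && T i) = true := by
    rintro l ⟨i, hi1, hi2⟩
    rw [List.any_eq_true]
    exact ⟨i, List.mem_finRange i, by simp [hi1, hi2]⟩
  apply key
  simp only [Bool.and_eq_true, and_assoc]
  refine ⟨?_, ?_, ?_, ?_, ?_, ?_, ?_, ?_, ?_, ?_, ?_, ?_, ?_, ?_, ?_, ?_, ?_⟩
  · simpa [cutOf, src, dst, List.finRange_succ, or_assoc] using conv _ h1
  · simpa [cutOf, src, dst, List.finRange_succ, or_assoc] using conv _ h2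
  · simpa [cutOf, src, dst, List.finRange_succ, or_assoc] using conv _ h3
  · simpa [cutOf, src, dst, List.finRange_succ, or_assoc] using conv _ h4
  · simpa [cutOf, src, dst, List.finRange_succ, or_assoc] using conv _ h5
  · simpa [cutOf, src, dst, List.finRange_succ, or_assoc] using conv _ h6
  · simpa [cutOf, src, dst, List.finRange_succ, or_assoc] using conv _ h7
  · simpa [cutOf, src, dst, List.finRange_succ, or_assoc] using conv _ h8
  · simpa [cutOf, src, dst, List.finRange_succ, or_assoc] using conv _ h9
  · simpa [cutOf, src, dst, List.finRange_succ, or_assoc] using conv _ h10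
  · simpa [cutOf, src, dst, List.finRange_succ, or_assoc] using conv _ h11
  · simpa [cutOf, src, dst, List.finRange_succ, or_assoc] using conv _ h12
  · simpa [cutOf, src, dst, List.finRange_succ, or_assoc] using conv _ h13
  · simpa [cutOf, src, dst, List.finRange_succ, or_assoc] using conv _ h14
  · simpa [cutOf, src, dst, List.finRange_succ, or_assoc] using conv _ h15
  · simpa [cutOf, src, dst, List.finRange_succ, or_assoc] using conv _ h16
  · simpa [cutOf, src, dst, List.finRange_succ, or_assoc] using conv _ h17


/-! ### The cost function -/

/-- The cost function: weights on special edges, a small cost `ε` off `F` and a large cost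
off `H`. -/
noncomputable def cfun (e : Fin 11 → Sym2 V) (F H : Finset (Sym2 V)) (ε : ℝ) (y : Sym2 V) : ℝ :=
  (∑ i, if y = e i then (wt i : ℝ) else 0) + (if y ∈ F then 0 else ε) +
    (if y ∈ H then 0 else 1000)

lemma cfun_nonneg (e : Fin 11 → Sym2 V) (F H : Finset (Sym2 V)) {ε : ℝ} (hε : 0 < ε)
    (y : Sym2 V) : 0 ≤ cfun e F H ε y := by
  unfold cfun
  have : 0 ≤ ∑ i, if y = e i then (wt i : ℝ) else 0 := by
    apply Finset.sum_nonneg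
    intro i _
    split_ifs <;> positivity
  have h2 : (0 : ℝ) ≤ (if y ∈ F then 0 else ε) := by split_ifs <;> linarith
  have h3 : (0 : ℝ) ≤ (if y ∈ H then 0 else 1000) := by split_ifs <;> linarith
  linarith

lemma sum_cfun (e : Fin 11 → Sym2 V) (F H : Finset (Sym2 V)) (ε : ℝ) (X : Finset (Sym2 V)) :
    ∑ y ∈ X, cfun e F H ε y = (((∑ i, if e i ∈ X then wt i else 0 : ℕ)) : ℝ) +
      (∑ y ∈ X, if y ∈ F then 0 else ε) + (∑ y ∈ X, if y ∈ H then (0 : ℝ) else 1000) := by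
  unfold cfun
  rw [Finset.sum_add_distrib, Finset.sum_add_distrib]
  congr 2
  rw [Finset.sum_comm]
  push_cast
  apply Finset.sum_congr rfl
  intro i _
  rw [Finset.sum_ite_eq']

lemma lower {e : Fin 11 → Sym2 V} {F H : Finset (Sym2 V)} {ε : ℝ} (hε : 0 < ε)
    {G : SimpleGraph V} {u v w x : V} {φ : V → ℕ}
    (hcl : ∀ y z, s(y, z) ∈ H → ∀ σ : ℕ → Bool, σ (φ y) ≠ σ (φ z) →
      ∃ i, e i = s(y, z) ∧ σ (src i) ≠ σ (dst i))
    (hu : φ u = 0) (hv : φ v = 4) (hw : φ w = 5) (hx : φ x = 6)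
    {X D1 D2 : Finset (Sym2 V)} (h1 : PathSet G u v D1) (h2 : PathSet G w x D2)
    (h1X : D1 ⊆ X) (h2X : D2 ⊆ X) (hc : ∑ y ∈ X, cfun e F H ε y ≤ 330) : X ⊆ F := by
  rw [sum_cfun] at hc
  have n1 : (0 : ℝ) ≤ (((∑ i, if e i ∈ X then wt i else 0 : ℕ)) : ℝ) := by positivity
  have n2 : ∀ y ∈ X, (0 : ℝ) ≤ (if y ∈ F then 0 else ε) := by
    intro y _; split_ifs <;> linarith
  have n3 : ∀ y ∈ X, (0 : ℝ) ≤ (if y ∈ H then 0 else 1000) := by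
    intro y _; split_ifs <;> linarith
  have s2 := Finset.sum_nonneg n2
  have s3 := Finset.sum_nonneg n3
  have hXH : ∀ y ∈ X, y ∈ H := by
    intro y hy
    by_contra hyH
    have := Finset.single_le_sum n3 hy
    simp only [hyH, if_false] at this
    linarith
  have key : 330 ≤ ∑ i, if e i ∈ X then wt i else 0 := by
    have := fin_core (fun i => decide (e i ∈ X)) ?_
    · simpa using this
    intro σ hσ
    have : ∃ y z, s(y, z) ∈ X ∧ σ (φ y) ≠ σ (φ z) := by
      rcases hσ with hσ | hσ
      · obtain ⟨p, hp, rfl⟩ := h1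
        obtain ⟨y, z, h3, h4⟩ := walk_cross (fun y => σ (φ y)) p (by simpa [hu, hv] using hσ)
        exact ⟨y, z, h1X (by simpa using h3), h4⟩
      · obtain ⟨p, hp, rfl⟩ := h2
        obtain ⟨y, z, h3, h4⟩ := walk_cross (fun y => σ (φ y)) p (by simpa [hw, hx] using hσ)
        exact ⟨y, z, h2X (by simpa using h3), h4⟩
    obtain ⟨y, z, h3, h4⟩ := this
    obtain ⟨i, h5, h6⟩ := hcl y z (hXH _ h3) σ h4
    exact ⟨i, by simpa [h5] using h3, h6⟩
  have key' : (330 : ℝ) ≤ (((∑ i, if e i ∈ X then wt i else 0 : ℕ)) : ℝ) := by exact_mod_cast key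
  intro y hy
  by_contra hyF
  have := Finset.single_le_sum n2 hy
  simp only [hyF, if_false] at this
  linarith

lemma sum_cfun_le {e : Fin 11 → Sym2 V} {F H : Finset (Sym2 V)} {ε : ℝ} (hε : 0 < ε)
    {X : Finset (Sym2 V)} (hX : X ⊆ H) {n : ℕ} (hn : (∑ i, if e i ∈ X then wt i else 0) ≤ n) :
    ∑ y ∈ X, cfun e F H ε y ≤ n + X.card * ε := by
  rw [sum_cfun]
  have h1 : (((∑ i, if e i ∈ X then wt i else 0 : ℕ)) : ℝ) ≤ n := by exact_mod_cast hn
  have h2 : (∑ y ∈ X, if y ∈ F then 0 else ε) ≤ X.card * ε := by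
    rw [← nsmul_eq_mul]
    apply Finset.sum_le_card_nsmul
    intro y _
    split_ifs <;> linarith
  have h3 : (∑ y ∈ X, if y ∈ H then (0 : ℝ) else 1000) = 0 := by
    apply Finset.sum_eq_zero
    intro y hy
    simp [hX hy]
  linarith

lemma sum_wt (p : Fin 11 → Prop) [DecidablePred p] : (∑ i, if p i then wt i else 0) =
    (if p 0 then 100 else 0) + (if p 1 then 10 else 0) + (if p 2 then 10 else 0) +
      (if p 3 then 10 else 0) + (if p 4 then 100 else 0) + (if p 5 then 100 else 0) +
      (if p 6 then 13 else 0) + (if p 7 then 100 else 0) + (if p 8 then 100 else 0) +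
      (if p 9 then 8 else 0) + (if p 10 then 108 else 0) := by
  simp only [Fin.sum_univ_succ, wt]
  simp
  simp [add_assoc]

set_option maxHeartbeats 2000000 in
/-- Abstract assembly of the core. -/
lemma core_of [Fintype V] {G : SimpleGraph V} {u v w x : V} {φ : V → ℕ}
    {e : Fin 11 → Sym2 V} {EU EL Q1 Q2 Q3 E1 E2 E3 H : Finset (Sym2 V)}
    (hU : PathSet G u v EU) (hL : PathSet G w x EL)
    (h1 : PathSet G u v E1) (h2 : PathSet G w x E2) (h3 : PathSet G w x E3)
    (acyc : (SimpleGraph.fromEdgeSet (↑(EU ∪ EL) : Set (Sym2 V))).IsAcyclic)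
    (hHd : H = EU ∪ EL ∪ Q1 ∪ Q2 ∪ Q3)
    (hcl : ∀ y z, s(y, z) ∈ H → ∀ σ : ℕ → Bool, σ (φ y) ≠ σ (φ z) →
      ∃ i, e i = s(y, z) ∧ σ (src i) ≠ σ (dst i))
    (hu : φ u = 0) (hv : φ v = 4) (hw : φ w = 5) (hx : φ x = 6)
    (m0 : e 0 ∈ EL ∧ e 0 ∉ EU) (m1 : e 1 ∈ EU ∧ e 1 ∈ EL) (m2 : e 2 ∈ EU ∧ e 2 ∈ EL)
    (m3 : e 3 ∈ EU ∧ e 3 ∈ EL) (m4 : e 4 ∈ EU ∧ e 4 ∉ EL) (m5 : e 5 ∈ EL ∧ e 5 ∉ EU)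
    (d12 : e 1 ≠ e 2) (d13 : e 1 ≠ e 3) (d23 : e 2 ≠ e 3)
    (mF : ∀ i : Fin 11, 6 ≤ i → e i ∉ EU ∧ e i ∉ EL)
    (mQ1 : ∀ i, e i ∈ Q1 → i = 6 ∨ i = 7)
    (mQ2 : ∀ i, e i ∈ Q2 → i = 8 ∨ i = 9)
    (mQ3 : ∀ i, e i ∈ Q3 → i = 10)
    (hE1 : E1 \ EU ⊆ Q1) (hE2 : E2 \ EL ⊆ Q2) (hE3 : E3 \ EL ⊆ Q3)
    (nE1 : e 1 ∉ E1 ∧ e 2 ∉ E1 ∧ e 3 ∉ E1 ∧ e 4 ∉ E1)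
    (nE2 : e 0 ∉ E2 ∧ e 1 ∉ E2 ∧ e 2 ∉ E2)
    (nE3 : e 2 ∉ E3 ∧ e 3 ∉ E3 ∧ e 5 ∉ E3) :
    ∃ c, Core G u v w x c EU EL E1 E2 E3 := by
  set N : ℕ := Fintype.card (Sym2 V) with hN
  set ε : ℝ := 1 / (4 * (N + 1)) with hεd
  have hN0 : (0 : ℝ) ≤ N := by positivity
  have hε : 0 < ε := by positivity
  have hεN : ∀ X : Finset (Sym2 V), X.card * ε ≤ 1 / 4 := by
    intro X
    have hX : (X.card : ℝ) ≤ N := by exact_mod_cast Finset.card_le_univ X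
    rw [hεd, mul_one_div, div_le_div_iff₀ (by positivity) (by norm_num)]
    linarith
  set c := cfun e (EU ∪ EL) H ε with hcd
  have hFH : EU ∪ EL ⊆ H := by
    intro y hy; rw [hHd]; simp only [Finset.mem_union] at hy ⊢; tauto
  have nn : ∀ y, 0 ≤ c y := cfun_nonneg _ _ _ hε
  have cF : cost c (EU ∪ EL) = 330 := by
    unfold cost
    rw [hcd, sum_cfun]
    have a1 : (∑ y ∈ EU ∪ EL, if y ∈ EU ∪ EL then (0 : ℝ) else ε) = 0 :=
      Finset.sum_eq_zero (fun y hy => by simp only [hy, if_true])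
    have a2 : (∑ y ∈ EU ∪ EL, if y ∈ H then (0 : ℝ) else 1000) = 0 :=
      Finset.sum_eq_zero (fun y hy => by simp only [hFH hy, if_true])
    rw [a1, a2, sum_wt (fun i => e i ∈ EU ∪ EL)]
    simp only [Finset.mem_union, m0, m1, m2, m3, m4, m5, mF 6 (by decide), mF 7 (by decide),
      mF 8 (by decide), mF 9 (by decide), mF 10 (by decide)]
    norm_num
  have cle : ∀ i, (wt i : ℝ) ≤ c (e i) := by
    intro i
    rw [hcd]; unfold cfun
    have : (wt i : ℝ) ≤ ∑ j, if e i = e j then (wt j : ℝ) else 0 := by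
      have := Finset.single_le_sum (f := fun j => if e i = e j then (wt j : ℝ) else 0)
        (s := Finset.univ) (fun j _ => by split_ifs <;> positivity) (Finset.mem_univ i)
      simpa using this
    have h2 : (0 : ℝ) ≤ (if e i ∈ EU ∪ EL then 0 else ε) := by split_ifs <;> linarith
    have h3 : (0 : ℝ) ≤ (if e i ∈ H then 0 else 1000) := by split_ifs <;> linarith
    linarith
  have cQ1 : ∑ y ∈ E1 \ EU, c y ≤ 113 + 1 / 4 := by
    have hsub : Q1 ⊆ H := by
      intro y hy; rw [hHd]; simp only [Finset.mem_union]; tauto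
    have a : ∑ y ∈ Q1, c y ≤ (113 : ℕ) + Q1.card * ε := by
      apply sum_cfun_le hε hsub
      rw [sum_wt (fun i => e i ∈ Q1)]
      have k : ∀ i, ¬ (i = 6 ∨ i = 7) → e i ∉ Q1 := fun i h h' => h (mQ1 i h')
      simp only [k 0 (by decide), k 1 (by decide), k 2 (by decide), k 3 (by decide),
        k 4 (by decide), k 5 (by decide), k 8 (by decide), k 9 (by decide), k 10 (by decide)]
      simp only [if_false, zero_add, add_zero]
      split_ifs <;> norm_num
    have b := Finset.sum_le_sum_of_subset_of_nonneg (f := c) hE1 (fun y _ _ => nn y)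
    have := hεN Q1
    push_cast at a
    linarith
  have cQ2 : ∑ y ∈ E2 \ EL, c y ≤ 108 + 1 / 4 := by
    have hsub : Q2 ⊆ H := by
      intro y hy; rw [hHd]; simp only [Finset.mem_union]; tauto
    have a : ∑ y ∈ Q2, c y ≤ (108 : ℕ) + Q2.card * ε := by
      apply sum_cfun_le hε hsub
      rw [sum_wt (fun i => e i ∈ Q2)]
      have k : ∀ i, ¬ (i = 8 ∨ i = 9) → e i ∉ Q2 := fun i h h' => h (mQ2 i h')
      simp only [k 0 (by decide), k 1 (by decide), k 2 (by decide), k 3 (by decide),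
        k 4 (by decide), k 5 (by decide), k 6 (by decide), k 7 (by decide), k 10 (by decide)]
      simp only [if_false, zero_add, add_zero]
      split_ifs <;> norm_num
    have b := Finset.sum_le_sum_of_subset_of_nonneg (f := c) hE2 (fun y _ _ => nn y)
    have := hεN Q2
    push_cast at a
    linarith
  have cQ3 : ∑ y ∈ E3 \ EL, c y ≤ 108 + 1 / 4 := by
    have hsub : Q3 ⊆ H := by
      intro y hy; rw [hHd]; simp only [Finset.mem_union]; tauto
    have a : ∑ y ∈ Q3, c y ≤ (108 : ℕ) + Q3.card * ε := by
      apply sum_cfun_le hε hsub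
      rw [sum_wt (fun i => e i ∈ Q3)]
      have k : ∀ i, ¬ (i = 10) → e i ∉ Q3 := fun i h h' => h (mQ3 i h')
      simp only [k 0 (by decide), k 1 (by decide), k 2 (by decide), k 3 (by decide),
        k 4 (by decide), k 5 (by decide), k 6 (by decide), k 7 (by decide), k 8 (by decide),
        k 9 (by decide)]
      simp only [if_false, zero_add, add_zero]
      split_ifs <;> norm_num
    have b := Finset.sum_le_sum_of_subset_of_nonneg (f := c) hE3 (fun y _ _ => nn y)
    have := hεN Q3
    push_cast at a
    linarith
  refine ⟨c, nn, hU, hL, h1, h2, h3, acyc, ?_, ?_⟩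
  · intro F' D1 D2 hD1 hD2 s1 s2 hc
    rw [cF] at hc
    have hsub : F' ⊆ EU ∪ EL := lower hε hcl hu hv hw hx hD1 hD2 s1 s2 hc
    apply Finset.Subset.antisymm hsub
    have e1 : EU = D1 := by
      obtain ⟨p, hp, rfl⟩ := hU
      obtain ⟨q, hq, rfl⟩ := hD1
      rw [path_unique_of_acyclic acyc p q hp hq (fun y hy => by simp [hy])
        (fun y hy => by exact_mod_cast hsub (s1 (by simpa using hy)))]
    have e2 : EL = D2 := by
      obtain ⟨p, hp, rfl⟩ := hL
      obtain ⟨q, hq, rfl⟩ := hD2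
      rw [path_unique_of_acyclic acyc p q hp hq (fun y hy => by simp [hy])
        (fun y hy => by exact_mod_cast hsub (s2 (by simpa using hy)))]
    rw [e1, e2]
    exact Finset.union_subset s1 s2
  · intro s t hs ht g1 g2 g3 k1 k2 k3
    have w0 : (100 : ℝ) ≤ c (e 0) := by
      have h := cle 0
      rwa [show wt 0 = 100 from rfl, Nat.cast_ofNat] at h
    have w1 : (10 : ℝ) ≤ c (e 1) := by
      have h := cle 1
      rwa [show wt 1 = 10 from rfl, Nat.cast_ofNat] at h
    have w2 : (10 : ℝ) ≤ c (e 2) := by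
      have h := cle 2
      rwa [show wt 2 = 10 from rfl, Nat.cast_ofNat] at h
    have w3 : (10 : ℝ) ≤ c (e 3) := by
      have h := cle 3
      rwa [show wt 3 = 10 from rfl, Nat.cast_ofNat] at h
    have w4 : (100 : ℝ) ≤ c (e 4) := by
      have h := cle 4
      rwa [show wt 4 = 100 from rfl, Nat.cast_ofNat] at h
    have w5 : (100 : ℝ) ≤ c (e 5) := by
      have h := cle 5
      rwa [show wt 5 = 100 from rfl, Nat.cast_ofNat] at h
    have t0 := g2 _ m0.1 m0.2
    have t5 := g2 _ m5.1 m5.2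
    have s4 := g1 _ m4.1 m4.2
    have st1 := g3 _ m1.1 m1.2
    have st2 := g3 _ m2.1 m2.2
    have st3 := g3 _ m3.1 m3.2
    have n4 : ∀ y, e 4 = y → y ∈ EL → False := fun y h h' => m4.2 (h ▸ h')
    have n0 : ∀ y, e 0 = y → y ∈ EU → False := fun y h h' => m0.2 (h ▸ h')
    have n5 : ∀ y, e 5 = y → y ∈ EU → False := fun y h h' => m5.2 (h ▸ h')
    have f1 : s (e 1) + (s (e 2) + (s (e 3) + s (e 4))) ≤ ∑ y ∈ EU \ E1, s y := by
      have hsub : ({e 1, e 2, e 3, e 4} : Finset (Sym2 V)) ⊆ EU \ E1 := by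
        intro y hy
        simp only [Finset.mem_insert, Finset.mem_singleton] at hy
        rw [Finset.mem_sdiff]
        rcases hy with rfl | rfl | rfl | rfl <;> tauto
      have := Finset.sum_le_sum_of_subset_of_nonneg (f := s) hsub (fun y _ _ => hs y)
      rw [Finset.sum_insert, Finset.sum_insert, Finset.sum_pair] at this
      · exact this
      · intro h; exact n4 _ h.symm m3.2
      · simp only [Finset.mem_insert, Finset.mem_singleton]
        rintro (h | h)
        · exact d23 h
        · exact n4 _ h.symm m2.2
      · simp only [Finset.mem_insert, Finset.mem_singleton]
        rintro (h | h | h)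
        · exact d12 h
        · exact d13 h
        · exact n4 _ h.symm m1.2
    have f2 : t (e 0) + (t (e 1) + t (e 2)) ≤ ∑ y ∈ EL \ E2, t y := by
      have hsub : ({e 0, e 1, e 2} : Finset (Sym2 V)) ⊆ EL \ E2 := by
        intro y hy
        simp only [Finset.mem_insert, Finset.mem_singleton] at hy
        rw [Finset.mem_sdiff]
        rcases hy with rfl | rfl | rfl <;> tauto
      have := Finset.sum_le_sum_of_subset_of_nonneg (f := t) hsub (fun y _ _ => ht y)
      rw [Finset.sum_insert, Finset.sum_pair d12] at this
      · exact this
      · simp only [Finset.mem_insert, Finset.mem_singleton]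
        rintro (h | h)
        · exact n0 _ h m1.1
        · exact n0 _ h m2.1
    have f3 : t (e 5) + (t (e 2) + t (e 3)) ≤ ∑ y ∈ EL \ E3, t y := by
      have hsub : ({e 5, e 2, e 3} : Finset (Sym2 V)) ⊆ EL \ E3 := by
        intro y hy
        simp only [Finset.mem_insert, Finset.mem_singleton] at hy
        rw [Finset.mem_sdiff]
        rcases hy with rfl | rfl | rfl <;> tauto
      have := Finset.sum_le_sum_of_subset_of_nonneg (f := t) hsub (fun y _ _ => ht y)
      rw [Finset.sum_insert, Finset.sum_pair d23] at this
      · exact this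
      · simp only [Finset.mem_insert, Finset.mem_singleton]
        rintro (h | h)
        · exact n5 _ h m2.1
        · exact n5 _ h m3.1
    have := ht (e 2)
    linarith


/-! ### Abstract configurations given by vertex sequences -/

/-- A bad configuration, in coordinates. -/
structure Cfg (V : Type*) where
  f : ℕ → V
  g : ℕ → V
  p1 : ℕ → V
  p2 : ℕ → V
  p3 : ℕ → V
  (nu nl lu ll m n1 n2 n3 k k2 k3 k4 jl ir jr : ℕ)
  h23 : k2 < k3
  h34 : k3 < k4
  h4m : k4 < m
  hjl : jl < ll
  hir : lu + m ≤ ir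
  hiru : ir < nu
  hjr : ll + m ≤ jr
  hjrl : jr < nl
  hk : k < n1
  hn2 : 1 ≤ n2
  hn3 : 1 ≤ n3
  fg : ∀ t, t ≤ m → f (lu + t) = g (ll + t)
  finj : ∀ i j, i ≤ nu → j ≤ nu → f i = f j → i = j
  ginj : ∀ i j, i ≤ nl → j ≤ nl → g i = g j → i = j
  meet : ∀ i j, i ≤ nu → j ≤ nl → f i = g j → ∃ t, t ≤ m ∧ i = lu + t ∧ j = ll + t
  p1lo : ∀ i, i ≤ k → (∃ i', i' ≤ lu + k2 ∧ f i' = p1 i) ∨ (∃ j, jl < j ∧ j ≤ ll ∧ g j = p1 i)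
  p1mid : ∀ i, k < i → i < n1 → (∀ j, j ≤ nu → f j ≠ p1 i) ∧ (∀ j, j ≤ nl → g j ≠ p1 i) ∧
    (∀ j, j ≤ n3 → p3 j ≠ p1 i)
  p1hi : ∃ i', ir < i' ∧ i' ≤ nu ∧ f i' = p1 n1
  p2lo : g jl = p2 0
  p2mid : ∀ i, 0 < i → i < n2 → (∀ j, j ≤ nu → f j ≠ p2 i) ∧ (∀ j, j ≤ nl → g j ≠ p2 i) ∧
    (∀ j, j ≤ n3 → p3 j ≠ p2 i)
  p2hi : ∃ j, ll + k3 < j ∧ j ≤ ll + k4 ∧ g j = p2 n2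
  p3lo : ∃ j, ll + k2 < j ∧ j ≤ ll + k3 ∧ g j = p3 0
  p3mid : ∀ i, 0 < i → i < n3 → (∀ j, j ≤ nu → f j ≠ p3 i) ∧ (∀ j, j ≤ nl → g j ≠ p3 i)
  p3hi : ∃ j, jr < j ∧ j ≤ nl ∧ g j = p3 n3

namespace Cfg

variable (C : Cfg V)

/-- Labels along the upper path. -/
def FU (i : ℕ) : ℕ :=
  if i ≤ C.lu + C.k2 then 0 else if i ≤ C.lu + C.k3 then 1 else if i ≤ C.lu + C.k4 then 2
  else if i ≤ C.ir then 3 else 4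

/-- Labels along the lower path. -/
def LG (j : ℕ) : ℕ :=
  if j ≤ C.jl then 5 else if j ≤ C.ll + C.k2 then 0 else if j ≤ C.ll + C.k3 then 1
  else if j ≤ C.ll + C.k4 then 2 else if j ≤ C.jr then 3 else 6

open Classical in
/-- The labelling of the vertices. -/
noncomputable def lab (y : V) : ℕ :=
  if h : ∃ i, i ≤ C.nu ∧ C.f i = y then C.FU h.choose
  else if h : ∃ j, j ≤ C.nl ∧ C.g j = y then C.LG h.choose
  else if ∃ i, i ≤ C.n3 ∧ C.p3 i = y then 1 else 7

lemma lab_f {i : ℕ} (hi : i ≤ C.nu) : C.lab (C.f i) = C.FU i := by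
  have h : ∃ j, j ≤ C.nu ∧ C.f j = C.f i := ⟨i, hi, rfl⟩
  unfold lab
  rw [dif_pos h]
  rw [C.finj _ _ h.choose_spec.1 hi h.choose_spec.2]

lemma lab_g {j : ℕ} (hj : j ≤ C.nl) : C.lab (C.g j) = C.LG j := by
  unfold lab
  by_cases h0 : ∃ i, i ≤ C.nu ∧ C.f i = C.g j
  · rw [dif_pos h0]
    obtain ⟨t, ht, h1, h2⟩ := C.meet _ _ h0.choose_spec.1 hj h0.choose_spec.2
    rw [h1, h2]
    have := C.hjl
    have := C.hir
    have := C.hjr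
    unfold FU LG
    split_ifs <;> omega
  · rw [dif_neg h0]
    have h : ∃ i, i ≤ C.nl ∧ C.g i = C.g j := ⟨j, hj, rfl⟩
    rw [dif_pos h]
    rw [C.ginj _ _ h.choose_spec.1 hj h.choose_spec.2]

lemma lab_off {y : V} (h1 : ∀ j, j ≤ C.nu → C.f j ≠ y) (h2 : ∀ j, j ≤ C.nl → C.g j ≠ y) :
    ((∃ i, i ≤ C.n3 ∧ C.p3 i = y) → C.lab y = 1) ∧
    ((∀ i, i ≤ C.n3 → C.p3 i ≠ y) → C.lab y = 7) := by
  unfold lab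
  rw [dif_neg (by rintro ⟨i, h, h'⟩; exact h1 i h h'),
    dif_neg (by rintro ⟨i, h, h'⟩; exact h2 i h h')]
  constructor
  · intro h; rw [if_pos h]
  · intro h; rw [if_neg (by rintro ⟨i, h', h''⟩; exact h i h' h'')]

lemma lab_p1 {i : ℕ} (hi : i ≤ C.n1) : (i ≤ C.k ∧ C.lab (C.p1 i) = 0) ∨
    (C.k < i ∧ i < C.n1 ∧ C.lab (C.p1 i) = 7) ∨ (i = C.n1 ∧ C.lab (C.p1 i) = 4) := by
  have := C.hjl
  have := C.hir
  have := C.hiru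
  have := C.hjr
  have := C.hjrl
  have := C.h23
  have := C.h34
  have := C.h4m
  rcases Nat.lt_or_ge C.k i with h | h
  · rcases Nat.lt_or_ge i C.n1 with h' | h'
    · right; left
      obtain ⟨a, b, c⟩ := C.p1mid i h h'
      exact ⟨h, h', (C.lab_off a b).2 c⟩
    · right; right
      obtain rfl : i = C.n1 := le_antisymm hi h'
      obtain ⟨j, h1, h2, h3⟩ := C.p1hi
      refine ⟨rfl, ?_⟩
      rw [← h3, C.lab_f h2]
      unfold FU
      split_ifs <;> omega
  · left
    refine ⟨h, ?_⟩
    rcases C.p1lo i h with ⟨j, h1, h2⟩ | ⟨j, h1, h2, h3⟩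
    · rw [← h2, C.lab_f (by omega)]
      unfold FU
      split_ifs <;> omega
    · rw [← h3, C.lab_g (by omega)]
      unfold LG
      split_ifs <;> omega

lemma lab_p2 {i : ℕ} (hi : i ≤ C.n2) : (i = 0 ∧ C.lab (C.p2 i) = 5) ∨
    (0 < i ∧ i < C.n2 ∧ C.lab (C.p2 i) = 7) ∨ (i = C.n2 ∧ C.lab (C.p2 i) = 2) := by
  have := C.hjl
  have := C.hjr
  have := C.hjrl
  have := C.h23
  have := C.h34
  have := C.h4m
  rcases Nat.eq_zero_or_pos i with h | h
  · left
    subst h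
    refine ⟨rfl, ?_⟩
    rw [← C.p2lo, C.lab_g (by omega)]
    unfold LG
    split_ifs <;> omega
  · right
    rcases Nat.lt_or_ge i C.n2 with h' | h'
    · left
      obtain ⟨a, b, c⟩ := C.p2mid i h h'
      exact ⟨h, h', (C.lab_off a b).2 c⟩
    · right
      obtain rfl : i = C.n2 := le_antisymm hi h'
      obtain ⟨j, h1, h2, h3⟩ := C.p2hi
      refine ⟨rfl, ?_⟩
      rw [← h3, C.lab_g (by omega)]
      unfold LG
      split_ifs <;> omega

lemma lab_p3 {i : ℕ} (hi : i ≤ C.n3) : (i < C.n3 ∧ C.lab (C.p3 i) = 1) ∨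
    (i = C.n3 ∧ C.lab (C.p3 i) = 6) := by
  have := C.hjl
  have := C.hjr
  have := C.hjrl
  have := C.h23
  have := C.h34
  have := C.h4m
  have := C.hn3
  rcases Nat.eq_zero_or_pos i with h | h
  · left
    subst h
    refine ⟨by omega, ?_⟩
    obtain ⟨j, h1, h2, h3⟩ := C.p3lo
    rw [← h3, C.lab_g (by omega)]
    unfold LG
    split_ifs <;> omega
  · rcases Nat.lt_or_ge i C.n3 with h' | h'
    · left
      obtain ⟨a, b⟩ := C.p3mid i h h'
      exact ⟨h', (C.lab_off a b).1 ⟨i, hi, rfl⟩⟩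
    · right
      obtain rfl : i = C.n3 := le_antisymm hi h'
      obtain ⟨j, h1, h2, h3⟩ := C.p3hi
      refine ⟨rfl, ?_⟩
      rw [← h3, C.lab_g (by omega)]
      unfold LG
      split_ifs <;> omega

/-- Label pair. -/
def LP (y z : V) (a b : ℕ) : Prop := C.lab y = a ∧ C.lab z = b

lemma edge_f {i : ℕ} (hi : i < C.nu) : C.lab (C.f i) = C.lab (C.f (i + 1)) ∨
    (i = C.lu + C.k2 ∧ C.LP (C.f i) (C.f (i + 1)) 0 1) ∨
    (i = C.lu + C.k3 ∧ C.LP (C.f i) (C.f (i + 1)) 1 2) ∨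
    (i = C.lu + C.k4 ∧ C.LP (C.f i) (C.f (i + 1)) 2 3) ∨
    (i = C.ir ∧ C.LP (C.f i) (C.f (i + 1)) 3 4) := by
  have := C.hir
  have := C.hiru
  have := C.h23
  have := C.h34
  have := C.h4m
  unfold LP
  rw [C.lab_f hi.le, C.lab_f (i := i + 1) hi]
  unfold FU
  split_ifs <;> omega

lemma edge_g {i : ℕ} (hi : i < C.nl) : C.lab (C.g i) = C.lab (C.g (i + 1)) ∨
    (i = C.jl ∧ C.LP (C.g i) (C.g (i + 1)) 5 0) ∨
    (i = C.ll + C.k2 ∧ C.LP (C.g i) (C.g (i + 1)) 0 1) ∨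
    (i = C.ll + C.k3 ∧ C.LP (C.g i) (C.g (i + 1)) 1 2) ∨
    (i = C.ll + C.k4 ∧ C.LP (C.g i) (C.g (i + 1)) 2 3) ∨
    (i = C.jr ∧ C.LP (C.g i) (C.g (i + 1)) 3 6) := by
  have := C.hjl
  have := C.hjr
  have := C.hjrl
  have := C.h23
  have := C.h34
  have := C.h4m
  unfold LP
  rw [C.lab_g hi.le, C.lab_g (j := i + 1) hi]
  unfold LG
  split_ifs <;> omega

lemma edge_p1 {i : ℕ} (hi : i < C.n1) : C.lab (C.p1 i) = C.lab (C.p1 (i + 1)) ∨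
    (i = C.k ∧ i ≠ C.n1 - 1 ∧ C.LP (C.p1 i) (C.p1 (i + 1)) 0 7) ∨
    (i = C.n1 - 1 ∧ i ≠ C.k ∧ C.LP (C.p1 i) (C.p1 (i + 1)) 7 4) ∨
    (i = C.k ∧ i = C.n1 - 1 ∧ C.LP (C.p1 i) (C.p1 (i + 1)) 0 4) := by
  have := C.hk
  have h1 := C.lab_p1 hi.le
  have h2 := C.lab_p1 (i := i + 1) hi
  unfold LP
  omega

lemma edge_p2 {i : ℕ} (hi : i < C.n2) : C.lab (C.p2 i) = C.lab (C.p2 (i + 1)) ∨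
    (i = 0 ∧ i ≠ C.n2 - 1 ∧ C.LP (C.p2 i) (C.p2 (i + 1)) 5 7) ∨
    (i = C.n2 - 1 ∧ i ≠ 0 ∧ C.LP (C.p2 i) (C.p2 (i + 1)) 7 2) ∨
    (i = 0 ∧ i = C.n2 - 1 ∧ C.LP (C.p2 i) (C.p2 (i + 1)) 5 2) := by
  have h1 := C.lab_p2 hi.le
  have h2 := C.lab_p2 (i := i + 1) hi
  unfold LP
  omega

lemma edge_p3 {i : ℕ} (hi : i < C.n3) : C.lab (C.p3 i) = C.lab (C.p3 (i + 1)) ∨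
    (i = C.n3 - 1 ∧ C.LP (C.p3 i) (C.p3 (i + 1)) 1 6) := by
  have h1 := C.lab_p3 hi.le
  have h2 := C.lab_p3 (i := i + 1) hi
  unfold LP
  omega

/-- The special edges. -/
def spe : Fin 11 → Sym2 V := ![s(C.g C.jl, C.g (C.jl + 1)),
  s(C.f (C.lu + C.k2), C.f (C.lu + C.k2 + 1)),
  s(C.f (C.lu + C.k3), C.f (C.lu + C.k3 + 1)),
  s(C.f (C.lu + C.k4), C.f (C.lu + C.k4 + 1)),
  s(C.f C.ir, C.f (C.ir + 1)), s(C.g C.jr, C.g (C.jr + 1)),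
  s(C.p1 C.k, C.p1 (C.k + 1)), s(C.p1 (C.n1 - 1), C.p1 (C.n1 - 1 + 1)),
  s(C.p2 0, C.p2 (0 + 1)), s(C.p2 (C.n2 - 1), C.p2 (C.n2 - 1 + 1)),
  s(C.p3 (C.n3 - 1), C.p3 (C.n3 - 1 + 1))]

/-- A numeric code for the label pair of an edge. -/
noncomputable def code (e : Sym2 V) : ℕ :=
  Sym2.lift ⟨fun y z => 10 * min (C.lab y) (C.lab z) + max (C.lab y) (C.lab z), by
    intro y z; simp only [min_comm, max_comm]⟩ e

lemma code_mk (y z : V) : C.code s(y, z) =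
    10 * min (C.lab y) (C.lab z) + max (C.lab y) (C.lab z) := rfl

lemma code_f {i : ℕ} (hi : i < C.nu) : C.code s(C.f i, C.f (i + 1)) % 11 = 0 ∨
    (i = C.lu + C.k2 ∧ C.code s(C.f i, C.f (i + 1)) = 1) ∨
    (i = C.lu + C.k3 ∧ C.code s(C.f i, C.f (i + 1)) = 12) ∨
    (i = C.lu + C.k4 ∧ C.code s(C.f i, C.f (i + 1)) = 23) ∨
    (i = C.ir ∧ C.code s(C.f i, C.f (i + 1)) = 34) := by
  have h := C.edge_f hi
  rw [code_mk]
  unfold LP at h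
  rcases h with h | h | h | h | h <;> omega

lemma code_g {i : ℕ} (hi : i < C.nl) : C.code s(C.g i, C.g (i + 1)) % 11 = 0 ∨
    (i = C.jl ∧ C.code s(C.g i, C.g (i + 1)) = 5) ∨
    (i = C.ll + C.k2 ∧ C.code s(C.g i, C.g (i + 1)) = 1) ∨
    (i = C.ll + C.k3 ∧ C.code s(C.g i, C.g (i + 1)) = 12) ∨
    (i = C.ll + C.k4 ∧ C.code s(C.g i, C.g (i + 1)) = 23) ∨
    (i = C.jr ∧ C.code s(C.g i, C.g (i + 1)) = 36) := by
  have h := C.edge_g hi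
  rw [code_mk]
  unfold LP at h
  rcases h with h | h | h | h | h | h <;> omega

lemma code_p1 {i : ℕ} (hi : i < C.n1) : C.code s(C.p1 i, C.p1 (i + 1)) % 11 = 0 ∨
    C.code s(C.p1 i, C.p1 (i + 1)) = 7 ∨ C.code s(C.p1 i, C.p1 (i + 1)) = 47 ∨
    C.code s(C.p1 i, C.p1 (i + 1)) = 4 := by
  have h := C.edge_p1 hi
  rw [code_mk]
  unfold LP at h
  rcases h with h | h | h | h <;> omega

lemma code_p2 {i : ℕ} (hi : i < C.n2) : C.code s(C.p2 i, C.p2 (i + 1)) % 11 = 0 ∨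
    C.code s(C.p2 i, C.p2 (i + 1)) = 57 ∨ C.code s(C.p2 i, C.p2 (i + 1)) = 27 ∨
    C.code s(C.p2 i, C.p2 (i + 1)) = 25 := by
  have h := C.edge_p2 hi
  rw [code_mk]
  unfold LP at h
  rcases h with h | h | h | h <;> omega

lemma code_p3 {i : ℕ} (hi : i < C.n3) : C.code s(C.p3 i, C.p3 (i + 1)) % 11 = 0 ∨
    C.code s(C.p3 i, C.p3 (i + 1)) = 16 := by
  have h := C.edge_p3 hi
  rw [code_mk]
  unfold LP at h
  rcases h with h | h <;> omega

lemma code_spe : C.code (C.spe 0) = 5 ∧ C.code (C.spe 1) = 1 ∧ C.code (C.spe 2) = 12 ∧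
    C.code (C.spe 3) = 23 ∧ C.code (C.spe 4) = 34 ∧ C.code (C.spe 5) = 36 ∧
    (C.code (C.spe 6) = 7 ∨ C.code (C.spe 6) = 4) ∧
    (C.code (C.spe 7) = 47 ∨ C.code (C.spe 7) = 4) ∧
    (C.code (C.spe 8) = 57 ∨ C.code (C.spe 8) = 25) ∧
    (C.code (C.spe 9) = 27 ∨ C.code (C.spe 9) = 25) ∧ C.code (C.spe 10) = 16 := by
  have := C.hjl
  have := C.hir
  have := C.hiru
  have := C.hjr
  have := C.hjrl
  have := C.h23
  have := C.h34
  have := C.h4m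
  have := C.hk
  have := C.hn2
  have := C.hn3
  refine ⟨?_, ?_, ?_, ?_, ?_, ?_, ?_, ?_, ?_, ?_, ?_⟩
  · have h0 : C.lab (C.g C.jl) = C.LG C.jl := C.lab_g (by omega)
    have h1 : C.lab (C.g (C.jl + 1)) = C.LG (C.jl + 1) := C.lab_g (by omega)
    change C.code s(C.g C.jl, C.g (C.jl + 1)) = 5
    rw [code_mk, h0, h1]; unfold LG; split_ifs <;> omega
  · have h0 : C.lab (C.f (C.lu + C.k2)) = C.FU (C.lu + C.k2) := C.lab_f (by omega)
    have h1 : C.lab (C.f (C.lu + C.k2 + 1)) = C.FU (C.lu + C.k2 + 1) := C.lab_f (by omega)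
    change C.code s(C.f (C.lu + C.k2), C.f (C.lu + C.k2 + 1)) = 1
    rw [code_mk, h0, h1]; unfold FU; split_ifs <;> omega
  · have h0 : C.lab (C.f (C.lu + C.k3)) = C.FU (C.lu + C.k3) := C.lab_f (by omega)
    have h1 : C.lab (C.f (C.lu + C.k3 + 1)) = C.FU (C.lu + C.k3 + 1) := C.lab_f (by omega)
    change C.code s(C.f (C.lu + C.k3), C.f (C.lu + C.k3 + 1)) = 12
    rw [code_mk, h0, h1]; unfold FU; split_ifs <;> omega
  · have h0 : C.lab (C.f (C.lu + C.k4)) = C.FU (C.lu + C.k4) := C.lab_f (by omega)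
    have h1 : C.lab (C.f (C.lu + C.k4 + 1)) = C.FU (C.lu + C.k4 + 1) := C.lab_f (by omega)
    change C.code s(C.f (C.lu + C.k4), C.f (C.lu + C.k4 + 1)) = 23
    rw [code_mk, h0, h1]; unfold FU; split_ifs <;> omega
  · have h0 : C.lab (C.f C.ir) = C.FU C.ir := C.lab_f (by omega)
    have h1 : C.lab (C.f (C.ir + 1)) = C.FU (C.ir + 1) := C.lab_f (by omega)
    change C.code s(C.f C.ir, C.f (C.ir + 1)) = 34
    rw [code_mk, h0, h1]; unfold FU; split_ifs <;> omega
  · have h0 : C.lab (C.g C.jr) = C.LG C.jr := C.lab_g (by omega)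
    have h1 : C.lab (C.g (C.jr + 1)) = C.LG (C.jr + 1) := C.lab_g (by omega)
    change C.code s(C.g C.jr, C.g (C.jr + 1)) = 36
    rw [code_mk, h0, h1]; unfold LG; split_ifs <;> omega
  · have h0 := C.lab_p1 (i := C.k) (by omega)
    have h1 := C.lab_p1 (i := C.k + 1) (by omega)
    change C.code s(C.p1 C.k, C.p1 (C.k + 1)) = 7 ∨ C.code s(C.p1 C.k, C.p1 (C.k + 1)) = 4
    rw [code_mk]; omega
  · have h0 := C.lab_p1 (i := C.n1 - 1) (by omega)
    have h1 := C.lab_p1 (i := C.n1 - 1 + 1) (by omega)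
    change C.code s(C.p1 (C.n1 - 1), C.p1 (C.n1 - 1 + 1)) = 47 ∨
      C.code s(C.p1 (C.n1 - 1), C.p1 (C.n1 - 1 + 1)) = 4
    rw [code_mk]; omega
  · have h0 := C.lab_p2 (i := 0) (by omega)
    have h1 := C.lab_p2 (i := 0 + 1) (by omega)
    change C.code s(C.p2 0, C.p2 (0 + 1)) = 57 ∨ C.code s(C.p2 0, C.p2 (0 + 1)) = 25
    rw [code_mk]; omega
  · have h0 := C.lab_p2 (i := C.n2 - 1) (by omega)
    have h1 := C.lab_p2 (i := C.n2 - 1 + 1) (by omega)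
    change C.code s(C.p2 (C.n2 - 1), C.p2 (C.n2 - 1 + 1)) = 27 ∨
      C.code s(C.p2 (C.n2 - 1), C.p2 (C.n2 - 1 + 1)) = 25
    rw [code_mk]; omega
  · have h0 := C.lab_p3 (i := C.n3 - 1) (by omega)
    have h1 := C.lab_p3 (i := C.n3 - 1 + 1) (by omega)
    change C.code s(C.p3 (C.n3 - 1), C.p3 (C.n3 - 1 + 1)) = 16
    rw [code_mk]; omega

end Cfg


lemma Cfg.hcl (C : Cfg V) {y z : V}
    (h : (∃ i, i < C.nu ∧ s(y, z) = s(C.f i, C.f (i + 1))) ∨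
      (∃ i, i < C.nl ∧ s(y, z) = s(C.g i, C.g (i + 1))) ∨
      (∃ i, i < C.n1 ∧ s(y, z) = s(C.p1 i, C.p1 (i + 1))) ∨
      (∃ i, i < C.n2 ∧ s(y, z) = s(C.p2 i, C.p2 (i + 1))) ∨
      (∃ i, i < C.n3 ∧ s(y, z) = s(C.p3 i, C.p3 (i + 1))))
    (σ : ℕ → Bool) (hσ : σ (C.lab y) ≠ σ (C.lab z)) :
    ∃ i, C.spe i = s(y, z) ∧ σ (src i) ≠ σ (dst i) := by
  have tr : ∀ a b : V, s(y, z) = s(a, b) → σ (C.lab a) ≠ σ (C.lab b) := by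
    intro a b hab
    rcases Sym2.eq_iff.1 hab with ⟨rfl, rfl⟩ | ⟨rfl, rfl⟩
    · exact hσ
    · exact hσ.symm
  rcases h with ⟨i, hi, he⟩ | ⟨i, hi, he⟩ | ⟨i, hi, he⟩ | ⟨i, hi, he⟩ | ⟨i, hi, he⟩
  · have hs := tr _ _ he
    rw [he]
    rcases C.edge_f hi with h | ⟨rfl, h1, h2⟩ | ⟨rfl, h1, h2⟩ | ⟨rfl, h1, h2⟩ | ⟨rfl, h1, h2⟩
    · exact absurd (by rw [h]) hs
    all_goals rw [h1, h2] at hs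
    · exact ⟨1, rfl, hs⟩
    · exact ⟨2, rfl, hs⟩
    · exact ⟨3, rfl, hs⟩
    · exact ⟨4, rfl, hs⟩
  · have hs := tr _ _ he
    rw [he]
    have hm : ∀ t, t < C.m → s(C.g (C.ll + t), C.g (C.ll + t + 1)) =
        s(C.f (C.lu + t), C.f (C.lu + t + 1)) := by
      intro t ht
      rw [add_assoc, add_assoc, C.fg t ht.le, C.fg (t + 1) ht]
    have := C.h23
    have := C.h34
    have := C.h4m
    rcases C.edge_g hi with h | ⟨rfl, h1, h2⟩ | ⟨rfl, h1, h2⟩ | ⟨rfl, h1, h2⟩ | ⟨rfl, h1, h2⟩ |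
      ⟨rfl, h1, h2⟩
    · exact absurd (by rw [h]) hs
    all_goals rw [h1, h2] at hs
    · exact ⟨0, rfl, hs⟩
    · exact ⟨1, (hm _ (by omega)).symm, hs⟩
    · exact ⟨2, (hm _ (by omega)).symm, hs⟩
    · exact ⟨3, (hm _ (by omega)).symm, hs⟩
    · exact ⟨5, rfl, hs⟩
  · have hs := tr _ _ he
    rw [he]
    rcases C.edge_p1 hi with h | ⟨rfl, h0, h1, h2⟩ | ⟨rfl, h0, h1, h2⟩ | ⟨h0, h0', h1, h2⟩
    · exact absurd (by rw [h]) hs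
    all_goals rw [h1, h2] at hs
    · exact ⟨6, rfl, hs⟩
    · exact ⟨7, rfl, hs⟩
    · by_cases h7 : σ 0 = σ 7
      · exact ⟨7, by rw [h0']; rfl, by rw [h7] at hs; exact hs⟩
      · exact ⟨6, by rw [h0]; rfl, h7⟩
  · have hs := tr _ _ he
    rw [he]
    rcases C.edge_p2 hi with h | ⟨rfl, h0, h1, h2⟩ | ⟨rfl, h0, h1, h2⟩ | ⟨h0, h0', h1, h2⟩
    · exact absurd (by rw [h]) hs
    all_goals rw [h1, h2] at hs
    · exact ⟨8, rfl, hs⟩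
    · exact ⟨9, rfl, hs⟩
    · by_cases h7 : σ 5 = σ 7
      · exact ⟨9, by rw [h0']; rfl, by rw [h7] at hs; exact hs⟩
      · exact ⟨8, by rw [h0]; rfl, h7⟩
  · have hs := tr _ _ he
    rw [he]
    rcases C.edge_p3 hi with h | ⟨rfl, h1, h2⟩
    · exact absurd (by rw [h]) hs
    rw [h1, h2] at hs
    exact ⟨10, rfl, hs⟩

lemma fin11 {P : Fin 11 → Prop} (h0 : P 0) (h1 : P 1) (h2 : P 2) (h3 : P 3) (h4 : P 4)
    (h5 : P 5) (h6 : P 6) (h7 : P 7) (h8 : P 8) (h9 : P 9) (h10 : P 10) : ∀ i, P i := by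
  intro i
  fin_cases i <;> assumption

lemma Cfg.kU (C : Cfg V) {i : ℕ} (hi : i < C.nu) {e : Sym2 V} (he : e = s(C.f i, C.f (i + 1))) :
    C.code e ∉ ({5, 36, 7, 4, 47, 57, 25, 27, 16} : Finset ℕ) := by
  have h := C.code_f hi
  rw [← he] at h
  simp only [Finset.mem_insert, Finset.mem_singleton]
  rcases h with h | h | h | h | h <;> omega

lemma Cfg.kL (C : Cfg V) {i : ℕ} (hi : i < C.nl) {e : Sym2 V} (he : e = s(C.g i, C.g (i + 1))) :
    C.code e ∉ ({34, 7, 4, 47, 57, 25, 27, 16} : Finset ℕ) := by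
  have h := C.code_g hi
  rw [← he] at h
  simp only [Finset.mem_insert, Finset.mem_singleton]
  rcases h with h | h | h | h | h | h <;> omega

lemma Cfg.kQ1 (C : Cfg V) {i : ℕ} (hi : i < C.n1) {e : Sym2 V}
    (he : e = s(C.p1 i, C.p1 (i + 1))) :
    C.code e ∉ ({5, 1, 12, 23, 34, 36, 57, 25, 27, 16} : Finset ℕ) := by
  have h := C.code_p1 hi
  rw [← he] at h
  simp only [Finset.mem_insert, Finset.mem_singleton]
  rcases h with h | h | h | h <;> omega

lemma Cfg.kQ2 (C : Cfg V) {i : ℕ} (hi : i < C.n2) {e : Sym2 V}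
    (he : e = s(C.p2 i, C.p2 (i + 1))) :
    C.code e ∉ ({5, 1, 12, 23, 34, 36, 7, 4, 47, 16} : Finset ℕ) := by
  have h := C.code_p2 hi
  rw [← he] at h
  simp only [Finset.mem_insert, Finset.mem_singleton]
  rcases h with h | h | h | h <;> omega

lemma Cfg.kQ3 (C : Cfg V) {i : ℕ} (hi : i < C.n3) {e : Sym2 V}
    (he : e = s(C.p3 i, C.p3 (i + 1))) :
    C.code e ∉ ({5, 1, 12, 23, 34, 36, 7, 4, 47, 57, 25, 27} : Finset ℕ) := by
  have h := C.code_p3 hi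
  rw [← he] at h
  simp only [Finset.mem_insert, Finset.mem_singleton]
  rcases h with h | h <;> omega

lemma Cfg.kE1 (C : Cfg V) {i : ℕ} (hi : i < C.nu) (ho : i < C.lu + C.k2 ∨ C.ir < i)
    {e : Sym2 V} (he : e = s(C.f i, C.f (i + 1))) :
    C.code e ∉ ({1, 12, 23, 34} : Finset ℕ) := by
  have h := C.code_f hi
  have j2 := C.hir
  have j6 := C.h23
  have j7 := C.h34
  have j8 := C.h4m
  rw [← he] at h
  simp only [Finset.mem_insert, Finset.mem_singleton]
  rcases h with h | h | h | h | h <;> omega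

lemma Cfg.kE2 (C : Cfg V) {i : ℕ} (hi : i < C.nl) (ho : i < C.jl ∨ C.ll + C.k3 < i)
    {e : Sym2 V} (he : e = s(C.g i, C.g (i + 1))) :
    C.code e ∉ ({5, 1, 12} : Finset ℕ) := by
  have h := C.code_g hi
  have j1 := C.hjl
  have j6 := C.h23
  rw [← he] at h
  simp only [Finset.mem_insert, Finset.mem_singleton]
  rcases h with h | h | h | h | h | h <;> omega

lemma Cfg.kE3 (C : Cfg V) {i : ℕ} (hi : i < C.nl) (ho : i < C.ll + C.k3 ∨ C.jr < i)
    {e : Sym2 V} (he : e = s(C.g i, C.g (i + 1))) :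
    C.code e ∉ ({12, 23, 36} : Finset ℕ) := by
  have h := C.code_g hi
  have j2 := C.hjr
  have j6 := C.h23
  have j7 := C.h34
  have j8 := C.h4m
  rw [← he] at h
  simp only [Finset.mem_insert, Finset.mem_singleton]
  rcases h with h | h | h | h | h | h <;> omega

set_option maxHeartbeats 1000000 in
/-- From a configuration in coordinates to the core. -/
lemma Cfg.core [Fintype V] (C : Cfg V) {G : SimpleGraph V} {u v w x : V}
    {EU EL Q1 Q2 Q3 E1 E2 E3 : Finset (Sym2 V)}
    (hU : PathSet G u v EU) (hL : PathSet G w x EL)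
    (h1 : PathSet G u v E1) (h2 : PathSet G w x E2) (h3 : PathSet G w x E3)
    (acyc : (SimpleGraph.fromEdgeSet (↑(EU ∪ EL) : Set (Sym2 V))).IsAcyclic)
    (hu : C.f 0 = u) (hv : C.f C.nu = v) (hw : C.g 0 = w) (hx : C.g C.nl = x)
    (memU : ∀ e, e ∈ EU ↔ ∃ i, i < C.nu ∧ e = s(C.f i, C.f (i + 1)))
    (memL : ∀ e, e ∈ EL ↔ ∃ i, i < C.nl ∧ e = s(C.g i, C.g (i + 1)))
    (memQ1 : ∀ e, e ∈ Q1 ↔ ∃ i, i < C.n1 ∧ e = s(C.p1 i, C.p1 (i + 1)))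
    (memQ2 : ∀ e, e ∈ Q2 ↔ ∃ i, i < C.n2 ∧ e = s(C.p2 i, C.p2 (i + 1)))
    (memQ3 : ∀ e, e ∈ Q3 ↔ ∃ i, i < C.n3 ∧ e = s(C.p3 i, C.p3 (i + 1)))
    (hE1 : ∀ e ∈ E1, (∃ i, (i < C.lu + C.k2 ∨ C.ir < i) ∧ i < C.nu ∧
      e = s(C.f i, C.f (i + 1))) ∨ e ∈ Q1)
    (hE2 : ∀ e ∈ E2, (∃ i, (i < C.jl ∨ C.ll + C.k3 < i) ∧ i < C.nl ∧
      e = s(C.g i, C.g (i + 1))) ∨ e ∈ Q2)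
    (hE3 : ∀ e ∈ E3, (∃ i, (i < C.ll + C.k3 ∨ C.jr < i) ∧ i < C.nl ∧
      e = s(C.g i, C.g (i + 1))) ∨ e ∈ Q3) :
    ∃ c, Core G u v w x c EU EL E1 E2 E3 := by
  have j1 := C.hjl
  have j2 := C.hir
  have j3 := C.hiru
  have j4 := C.hjr
  have j5 := C.hjrl
  have j6 := C.h23
  have j7 := C.h34
  have j8 := C.h4m
  have hm : ∀ t, t < C.m → s(C.g (C.ll + t), C.g (C.ll + t + 1)) =
      s(C.f (C.lu + t), C.f (C.lu + t + 1)) := by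
    intro t ht
    rw [add_assoc, add_assoc, C.fg t ht.le, C.fg (t + 1) ht]
  have kU : ∀ e, e ∈ EU → C.code e ∉ _ := fun e he =>
    let ⟨_, hi, h⟩ := (memU e).1 he
    C.kU hi h
  have kL : ∀ e, e ∈ EL → C.code e ∉ _ := fun e he =>
    let ⟨_, hi, h⟩ := (memL e).1 he
    C.kL hi h
  have kQ1 : ∀ e, e ∈ Q1 → C.code e ∉ _ := fun e he =>
    let ⟨_, hi, h⟩ := (memQ1 e).1 he
    C.kQ1 hi h
  have kQ2 : ∀ e, e ∈ Q2 → C.code e ∉ _ := fun e he =>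
    let ⟨_, hi, h⟩ := (memQ2 e).1 he
    C.kQ2 hi h
  have kQ3 : ∀ e, e ∈ Q3 → C.code e ∉ _ := fun e he =>
    let ⟨_, hi, h⟩ := (memQ3 e).1 he
    C.kQ3 hi h
  have kE1 : ∀ e, e ∈ E1 → C.code e ∉ ({1, 12, 23, 34} : Finset ℕ) := by
    intro e he
    rcases hE1 e he with ⟨i, h, hi, h'⟩ | h
    · exact C.kE1 hi h h'
    · exact fun hh => kQ1 e h (by revert hh; generalize C.code e = n; revert n; simp)
  have kE2 : ∀ e, e ∈ E2 → C.code e ∉ ({5, 1, 12} : Finset ℕ) := by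
    intro e he
    rcases hE2 e he with ⟨i, h, hi, h'⟩ | h
    · exact C.kE2 hi h h'
    · exact fun hh => kQ2 e h (by revert hh; generalize C.code e = n; revert n; simp)
  have kE3 : ∀ e, e ∈ E3 → C.code e ∉ ({12, 23, 36} : Finset ℕ) := by
    intro e he
    rcases hE3 e he with ⟨i, h, hi, h'⟩ | h
    · exact C.kE3 hi h h'
    · exact fun hh => kQ3 e h (by revert hh; generalize C.code e = n; revert n; simp)
  have hc := C.code_spe
  refine core_of (φ := C.lab) (e := C.spe) (Q1 := Q1) (Q2 := Q2) (Q3 := Q3) hU hL h1 h2 h3 acyc rfl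
    ?_ ?_ ?_ ?_ ?_ ⟨?_, ?_⟩ ⟨?_, ?_⟩ ⟨?_, ?_⟩ ⟨?_, ?_⟩ ⟨?_, ?_⟩ ⟨?_, ?_⟩ ?_ ?_ ?_ ?_ ?_ ?_ ?_
    ?_ ?_ ?_ ?_ ?_ ?_
  · intro y z hyz σ hσ
    simp only [Finset.mem_union, memU, memL, memQ1, memQ2, memQ3] at hyz
    simp only [or_assoc] at hyz
    exact C.hcl hyz σ hσ
  · rw [← hu, C.lab_f (by clear hc; omega)]; unfold FU; split_ifs <;> first | rfl | (clear hc; omega)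
  · rw [← hv, C.lab_f (by clear hc; omega)]; unfold FU; split_ifs <;> first | rfl | (clear hc; omega)
  · rw [← hw, C.lab_g (by clear hc; omega)]; unfold LG; split_ifs <;> first | rfl | (clear hc; omega)
  · rw [← hx, C.lab_g (by clear hc; omega)]; unfold LG; split_ifs <;> first | rfl | (clear hc; omega)
  · exact (memL _).2 ⟨C.jl, by clear hc; omega, rfl⟩
  · intro h; exact kU _ h (by simp [hc.1])
  · exact (memU _).2 ⟨C.lu + C.k2, by clear hc; omega, rfl⟩
  · exact (memL _).2 ⟨C.ll + C.k2, by clear hc; omega, (hm _ (by clear hc; omega)).symm⟩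
  · exact (memU _).2 ⟨C.lu + C.k3, by clear hc; omega, rfl⟩
  · exact (memL _).2 ⟨C.ll + C.k3, by clear hc; omega, (hm _ (by clear hc; omega)).symm⟩
  · exact (memU _).2 ⟨C.lu + C.k4, by clear hc; omega, rfl⟩
  · exact (memL _).2 ⟨C.ll + C.k4, by clear hc; omega, (hm _ (by clear hc; omega)).symm⟩
  · exact (memU _).2 ⟨C.ir, by clear hc; omega, rfl⟩
  · intro h; exact kL _ h (by simp [hc.2.2.2.2.1])
  · exact (memL _).2 ⟨C.jr, by clear hc; omega, rfl⟩
  · intro h; exact kU _ h (by simp [hc.2.2.2.2.2.1])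
  all_goals obtain ⟨c0, c1, c2, c3, c4, c5, c6, c7, c8, c9, c10⟩ := hc
  · intro h; rw [h, c2] at c1; exact absurd c1 (by decide)
  · intro h; rw [h, c3] at c1; exact absurd c1 (by decide)
  · intro h; rw [h, c3] at c2; exact absurd c2 (by decide)
  · refine fin11 ?_ ?_ ?_ ?_ ?_ ?_ ?_ ?_ ?_ ?_ ?_
    · intro h; exact absurd h (by decide)
    · intro h; exact absurd h (by decide)
    · intro h; exact absurd h (by decide)
    · intro h; exact absurd h (by decide)
    · intro h; exact absurd h (by decide)
    · intro h; exact absurd h (by decide)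
    all_goals intro _; refine ⟨fun h => kU _ h ?_, fun h => kL _ h ?_⟩
    · rcases c6 with h | h <;> simp [h]
    · rcases c6 with h | h <;> simp [h]
    · rcases c7 with h | h <;> simp [h]
    · rcases c7 with h | h <;> simp [h]
    · rcases c8 with h | h <;> simp [h]
    · rcases c8 with h | h <;> simp [h]
    · rcases c9 with h | h <;> simp [h]
    · rcases c9 with h | h <;> simp [h]
    · simp [c10]
    · simp [c10]
  · refine fin11 ?_ ?_ ?_ ?_ ?_ ?_ ?_ ?_ ?_ ?_ ?_ <;> intro h
    · exact absurd (by simp [c0]) (kQ1 _ h)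
    · exact absurd (by simp [c1]) (kQ1 _ h)
    · exact absurd (by simp [c2]) (kQ1 _ h)
    · exact absurd (by simp [c3]) (kQ1 _ h)
    · exact absurd (by simp [c4]) (kQ1 _ h)
    · exact absurd (by simp [c5]) (kQ1 _ h)
    · exact Or.inl rfl
    · exact Or.inr rfl
    · exact absurd (by rcases c8 with h | h <;> simp [h]) (kQ1 _ h)
    · exact absurd (by rcases c9 with h | h <;> simp [h]) (kQ1 _ h)
    · exact absurd (by simp [c10]) (kQ1 _ h)
  · refine fin11 ?_ ?_ ?_ ?_ ?_ ?_ ?_ ?_ ?_ ?_ ?_ <;> intro h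
    · exact absurd (by simp [c0]) (kQ2 _ h)
    · exact absurd (by simp [c1]) (kQ2 _ h)
    · exact absurd (by simp [c2]) (kQ2 _ h)
    · exact absurd (by simp [c3]) (kQ2 _ h)
    · exact absurd (by simp [c4]) (kQ2 _ h)
    · exact absurd (by simp [c5]) (kQ2 _ h)
    · exact absurd (by rcases c6 with h | h <;> simp [h]) (kQ2 _ h)
    · exact absurd (by rcases c7 with h | h <;> simp [h]) (kQ2 _ h)
    · exact Or.inl rfl
    · exact Or.inr rfl
    · exact absurd (by simp [c10]) (kQ2 _ h)
  · refine fin11 ?_ ?_ ?_ ?_ ?_ ?_ ?_ ?_ ?_ ?_ ?_ <;> intro h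
    · exact absurd (by simp [c0]) (kQ3 _ h)
    · exact absurd (by simp [c1]) (kQ3 _ h)
    · exact absurd (by simp [c2]) (kQ3 _ h)
    · exact absurd (by simp [c3]) (kQ3 _ h)
    · exact absurd (by simp [c4]) (kQ3 _ h)
    · exact absurd (by simp [c5]) (kQ3 _ h)
    · exact absurd (by rcases c6 with h | h <;> simp [h]) (kQ3 _ h)
    · exact absurd (by rcases c7 with h | h <;> simp [h]) (kQ3 _ h)
    · exact absurd (by rcases c8 with h | h <;> simp [h]) (kQ3 _ h)
    · exact absurd (by rcases c9 with h | h <;> simp [h]) (kQ3 _ h)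
    · rfl
  · intro e he
    rw [Finset.mem_sdiff] at he
    rcases hE1 e he.1 with ⟨i, _, hi, h⟩ | h
    · exact absurd ((memU e).2 ⟨i, hi, h⟩) he.2
    · exact h
  · intro e he
    rw [Finset.mem_sdiff] at he
    rcases hE2 e he.1 with ⟨i, _, hi, h⟩ | h
    · exact absurd ((memL e).2 ⟨i, hi, h⟩) he.2
    · exact h
  · intro e he
    rw [Finset.mem_sdiff] at he
    rcases hE3 e he.1 with ⟨i, _, hi, h⟩ | h
    · exact absurd ((memL e).2 ⟨i, hi, h⟩) he.2
    · exact h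
  · exact ⟨fun h => kE1 _ h (by simp [c1]), fun h => kE1 _ h (by simp [c2]),
      fun h => kE1 _ h (by simp [c3]), fun h => kE1 _ h (by simp [c4])⟩
  · exact ⟨fun h => kE2 _ h (by simp [c0]), fun h => kE2 _ h (by simp [c1]),
      fun h => kE2 _ h (by simp [c2])⟩
  · exact ⟨fun h => kE3 _ h (by simp [c2]), fun h => kE3 _ h (by simp [c3]),
      fun h => kE3 _ h (by simp [c5])⟩


/-! ### Extraction of coordinates from a PBC -/

section extraction

variable {G : SimpleGraph V} {u v w x : V}

lemma dev {P : G.Walk u v} {s t : ℕ} {a b : V} (ha : P.getVert s = a) (hb : P.getVert t = b)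
    (q : G.Walk a b) :
    ∃ E, PathSet G u v E ∧ ∀ e ∈ E, (∃ i, (i < s ∨ t ≤ i) ∧ i < P.length ∧
      e = s(P.getVert i, P.getVert (i + 1))) ∨ e ∈ q.edges := by
  subst ha hb
  refine ⟨(((P.take s).append q).append (P.drop t)).bypass.edges.toFinset,
    ⟨_, SimpleGraph.Walk.bypass_isPath _, rfl⟩, ?_⟩
  intro e he
  rw [List.mem_toFinset] at he
  have he := SimpleGraph.Walk.edges_bypass_subset_edges _ he
  rw [SimpleGraph.Walk.edges_append, SimpleGraph.Walk.edges_append, List.mem_append,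
    List.mem_append] at he
  rcases he with (he | he) | he
  · obtain ⟨i, h1, h2, h3⟩ := take_edges _ _ _ he
    exact Or.inl ⟨i, Or.inl h1, h2, h3⟩
  · exact Or.inr he
  · obtain ⟨i, h1, h2, h3⟩ := drop_edges _ _ _ he
    exact Or.inl ⟨i, Or.inr h1, h2, h3⟩

lemma app_len {a b : V} (L : G.Walk u a) (M : G.Walk a b) (R : G.Walk b v) :
    ((L.append M).append R).length = L.length + M.length + R.length := by
  simp

lemma app_L {a b : V} (L : G.Walk u a) (M : G.Walk a b) (R : G.Walk b v) {i : ℕ}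
    (hi : i ≤ L.length) : ((L.append M).append R).getVert i = L.getVert i := by
  rw [← SimpleGraph.Walk.append_assoc, SimpleGraph.Walk.getVert_append]
  split_ifs with h
  · rfl
  · obtain rfl : i = L.length := by omega
    simp

lemma app_R {a b : V} (L : G.Walk u a) (M : G.Walk a b) (R : G.Walk b v) (t : ℕ) :
    ((L.append M).append R).getVert (L.length + M.length + t) = R.getVert t := by
  rw [SimpleGraph.Walk.getVert_append]
  rw [if_neg (by simp), SimpleGraph.Walk.length_append]
  congr 1; omega

lemma app_M {a b : V} (L : G.Walk u a) (M : G.Walk a b) (R : G.Walk b v) {t : ℕ}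
    (ht : t ≤ M.length) : ((L.append M).append R).getVert (L.length + t) = M.getVert t := by
  rcases Nat.lt_or_ge t M.length with h | h
  · rw [SimpleGraph.Walk.getVert_append, if_pos (by simp; omega),
      SimpleGraph.Walk.getVert_append, if_neg (by omega)]
    congr 1; omega
  · obtain rfl : t = M.length := by omega
    have := app_R L M R 0
    simpa using this

lemma app_Ls {a b : V} (L : G.Walk u a) (M : G.Walk a b) (R : G.Walk b v) (y : V) :
    y ∈ L.support ↔ ∃ i, i ≤ L.length ∧ ((L.append M).append R).getVert i = y := by
  rw [mem_support_iff']
  constructor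
  · rintro ⟨i, hi, h⟩; exact ⟨i, hi, by rw [app_L _ _ _ hi, h]⟩
  · rintro ⟨i, hi, h⟩; exact ⟨i, hi, by rw [← h, app_L _ _ _ hi]⟩

lemma app_Rs {a b : V} (L : G.Walk u a) (M : G.Walk a b) (R : G.Walk b v) {i : ℕ}
    (h1 : L.length + M.length ≤ i) (h2 : i ≤ ((L.append M).append R).length) :
    ((L.append M).append R).getVert i ∈ R.support := by
  rw [app_len] at h2
  rw [mem_support_iff']
  refine ⟨i - (L.length + M.length), by omega, ?_⟩
  rw [← app_R L M R]; congr 1; omega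

lemma app_Le {a b : V} (L : G.Walk u a) (M : G.Walk a b) (R : G.Walk b v) {e : Sym2 V}
    (he : e ∈ L.edges) : ∃ i, i < L.length ∧ e = s(((L.append M).append R).getVert i,
      ((L.append M).append R).getVert (i + 1)) := by
  obtain ⟨i, hi, rfl⟩ := (mem_edges_iff _ _).1 he
  exact ⟨i, hi, by rw [app_L _ _ _ hi.le, app_L _ _ _ (show i + 1 ≤ _ from hi)]⟩

lemma app_Me {a b : V} (L : G.Walk u a) (M : G.Walk a b) (R : G.Walk b v) {e : Sym2 V}
    (he : e ∈ M.edges) : ∃ i, i < M.length ∧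
      e = s(((L.append M).append R).getVert (L.length + i),
      ((L.append M).append R).getVert (L.length + i + 1)) ∧ e = s(M.getVert i, M.getVert (i + 1)) := by
  obtain ⟨i, hi, rfl⟩ := (mem_edges_iff _ _).1 he
  exact ⟨i, hi, by rw [app_M _ _ _ hi.le, add_assoc, app_M _ _ _ (show i + 1 ≤ _ from hi)], rfl⟩

lemma app_Re {a b : V} (L : G.Walk u a) (M : G.Walk a b) (R : G.Walk b v) {e : Sym2 V}
    (he : e ∈ R.edges) : ∃ i, L.length + M.length ≤ i ∧ i < ((L.append M).append R).length ∧
      e = s(((L.append M).append R).getVert i, ((L.append M).append R).getVert (i + 1)) := by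
  obtain ⟨i, hi, rfl⟩ := (mem_edges_iff _ _).1 he
  refine ⟨L.length + M.length + i, by omega, by rw [app_len]; omega, ?_⟩
  rw [app_R, add_assoc, app_R]

lemma vinj {P : G.Walk u v} (hP : P.IsPath) : ∀ i j, i ≤ P.length → j ≤ P.length →
    P.getVert i = P.getVert j → i = j :=
  fun _ _ hi hj h => hP.getVert_injOn hi hj h

lemma einj {P : G.Walk u v} (hP : P.IsPath) {i j : ℕ} (hi : i < P.length) (hj : j < P.length)
    (h : s(P.getVert i, P.getVert (i + 1)) = s(P.getVert j, P.getVert (j + 1))) : i = j := by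
  rcases Sym2.eq_iff.1 h with ⟨h1, _⟩ | ⟨h1, h2⟩
  · exact vinj hP _ _ hi.le hj.le h1
  · have := vinj hP _ _ hi.le (show j + 1 ≤ _ from hj) h1
    have := vinj hP _ _ (show i + 1 ≤ _ from hi) hj.le h2
    omega

/-- In a forest, a segment of `P` between two vertices of `Q` runs along `Q`. -/
lemma seg_sub {P : G.Walk u v} {Q : G.Walk w x} (hP : P.IsPath) (hQ : Q.IsPath)
    (hac : (SimpleGraph.fromEdgeSet {e | e ∈ P.edges ∨ e ∈ Q.edges}).IsAcyclic)
    {a b c d : ℕ} (hab : a ≤ b) (hb : b ≤ P.length) (hc : c ≤ Q.length) (hd : d ≤ Q.length)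
    (h1 : P.getVert a = Q.getVert c) (h2 : P.getVert b = Q.getVert d) {t : ℕ} (hat : a ≤ t)
    (htb : t < b) : s(P.getVert t, P.getVert (t + 1)) ∈ Q.edges := by
  obtain ⟨p, hp, hpe⟩ := seg_exists P hP a b hab hb
  have : ∃ q : G.Walk (Q.getVert c) (Q.getVert d), q.IsPath ∧ ∀ e ∈ q.edges, e ∈ Q.edges := by
    rcases le_total c d with h | h
    · obtain ⟨q, hq, hqe⟩ := seg_exists Q hQ c d h hd
      refine ⟨q, hq, fun e he => ?_⟩
      obtain ⟨i, h3, h4, h5⟩ := (hqe e).1 he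
      exact (mem_edges_iff _ _).2 ⟨i, by omega, h5⟩
    · obtain ⟨q, hq, hqe⟩ := seg_exists Q hQ d c h hc
      refine ⟨q.reverse, hq.reverse, fun e he => ?_⟩
      rw [SimpleGraph.Walk.edges_reverse, List.mem_reverse] at he
      obtain ⟨i, h3, h4, h5⟩ := (hqe e).1 he
      exact (mem_edges_iff _ _).2 ⟨i, by omega, h5⟩
  obtain ⟨q, hq, hqe⟩ := this
  have hpe2 : ∀ e ∈ (p.copy h1 h2).edges, e ∈ {e | e ∈ P.edges ∨ e ∈ Q.edges} := by
    intro e he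
    rw [SimpleGraph.Walk.edges_copy] at he
    obtain ⟨i, h3, h4, h5⟩ := (hpe e).1 he
    exact Or.inl ((mem_edges_iff _ _).2 ⟨i, by omega, h5⟩)
  have := path_unique_of_acyclic hac (p.copy h1 h2) q (by simpa using hp) hq hpe2
    (fun e he => Or.inr (hqe e he))
  apply hqe
  rw [← this, SimpleGraph.Walk.edges_copy, hpe]
  exact ⟨t, hat, htb, rfl⟩

namespace PBC

variable (B : PBC G u v w x)

lemma fg {t : ℕ} (ht : t ≤ B.M.length) :
    B.Pu.getVert (B.Lu.length + t) = B.Pl.getVert (B.Ll.length + t) := by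
  unfold Pu Pl
  rw [app_M _ _ _ ht, app_M _ _ _ ht]

lemma Pu_len : B.Pu.length = B.Lu.length + B.M.length + B.Ru.length := app_len _ _ _

lemma Pl_len : B.Pl.length = B.Ll.length + B.M.length + B.Rl.length := app_len _ _ _

lemma meet {i j : ℕ} (hi : i ≤ B.Pu.length) (hj : j ≤ B.Pl.length)
    (h : B.Pu.getVert i = B.Pl.getVert j) :
    ∃ t, t ≤ B.M.length ∧ i = B.Lu.length + t ∧ j = B.Ll.length + t := by
  have hlu := B.Pu_len
  have hll := B.Pl_len
  have hM : ∀ t, t < B.Pu.length → s(B.Pu.getVert t, B.Pu.getVert (t + 1)) ∈ B.Pl.edges →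
      B.Lu.length ≤ t ∧ t < B.Lu.length + B.M.length := by
    intro t ht he
    have h1 := B.hmeet _ ((mem_edges_iff B.Pu _).2 ⟨t, ht, rfl⟩) he
    obtain ⟨k, hk, h2, _⟩ := app_Me B.Lu B.M B.Ru h1
    have := einj (P := B.Pu) B.hPu ht (by omega) h2
    omega
  rcases Nat.lt_or_ge i B.Lu.length with h1 | h1
  · exfalso
    have := seg_sub (P := B.Pu) (Q := B.Pl) B.hPu B.hPl B.hforest h1.le (by omega) hj
      (show B.Ll.length ≤ _ by omega) h (B.fg (t := 0) (by omega)) le_rfl h1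
    have := hM i (by omega) this
    omega
  rcases Nat.lt_or_ge (B.Lu.length + B.M.length) i with h2 | h2
  · exfalso
    have := seg_sub (P := B.Pu) (Q := B.Pl) B.hPu B.hPl B.hforest h2.le (by omega)
      (show B.Ll.length + B.M.length ≤ _ by omega) hj (B.fg le_rfl) h le_rfl h2
    have := hM _ (by omega) this
    omega
  · obtain ⟨t, rfl⟩ := Nat.exists_eq_add_of_le h1
    refine ⟨t, by omega, rfl, ?_⟩
    rw [B.fg (by omega)] at h
    exact (vinj (P := B.Pl) B.hPl _ _ (by omega) hj h).symm

/-- Numerical data of a PBC. -/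
lemma nums : ∃ s1 t1 s2 t2 s3 t3 k2 k3 k4 ir jr : ℕ,
    (k2 < k3 ∧ k3 < k4 ∧ k4 < B.M.length) ∧
    (s1 ≤ B.Lu.length + k2 ∧ B.Lu.length + B.M.length ≤ ir ∧ ir < t1 ∧ t1 ≤ B.Pu.length) ∧
    (s2 < B.Ll.length ∧ B.Ll.length + k3 < t2 ∧ t2 ≤ B.Ll.length + k4) ∧
    (B.Ll.length + k2 < s3 ∧ s3 ≤ B.Ll.length + k3 ∧ B.Ll.length + B.M.length ≤ jr ∧ jr < t3 ∧
      t3 ≤ B.Pl.length) ∧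
    (B.Pu.getVert s1 = B.a1 ∧ B.Pu.getVert t1 = B.b1) ∧
    (B.Pl.getVert s2 = B.a2 ∧ B.Pl.getVert t2 = B.b2) ∧
    (B.Pl.getVert s3 = B.a3 ∧ B.Pl.getVert t3 = B.b3) ∧
    (∀ e ∈ B.S2.edges, ∃ i, s2 ≤ i ∧ i < B.Pl.length ∧
      e = s(B.Pl.getVert i, B.Pl.getVert (i + 1))) := by
  have hlu := B.Pu_len
  have hll := B.Pl_len
  have iU : ∀ {i j : ℕ}, i < B.Pu.length → j < B.Pu.length →
    s(B.Pu.getVert i, B.Pu.getVert (i + 1)) = s(B.Pu.getVert j, B.Pu.getVert (j + 1)) → i = j :=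
    fun hi hj h => einj (P := B.Pu) B.hPu hi hj h
  have iL : ∀ {i j : ℕ}, i < B.Pl.length → j < B.Pl.length →
    s(B.Pl.getVert i, B.Pl.getVert (i + 1)) = s(B.Pl.getVert j, B.Pl.getVert (j + 1)) → i = j :=
    fun hi hj h => einj (P := B.Pl) B.hPl hi hj h
  have ne1 : B.S1.edges ≠ [] := by
    obtain ⟨e, he, _⟩ := B.hC1Ru; exact List.ne_nil_of_mem he
  have ne2 : B.S2.edges ≠ [] := by
    obtain ⟨e, he, _⟩ := B.hC2Ll; exact List.ne_nil_of_mem he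
  have ne3 : B.S3.edges ≠ [] := by
    obtain ⟨e, he, _⟩ := B.hC3Rl; exact List.ne_nil_of_mem he
  obtain ⟨s1, l1, a1, b1, m1⟩ := segment_pos B.Pu B.S1 B.hS1 ne1
  obtain ⟨s2, l2, a2, b2, m2⟩ := segment_pos B.Pl B.S2 B.hS2 ne2
  obtain ⟨s3, l3, a3, b3, m3⟩ := segment_pos B.Pl B.S3 B.hS3 ne3
  generalize B.S1.length = n1 at *
  generalize B.S2.length = n2 at *
  generalize B.S3.length = n3 at *
  have in1 : ∀ {i : ℕ}, i < B.Pu.length → (s(B.Pu.getVert i, B.Pu.getVert (i + 1)) ∈ B.S1.edges ↔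
      s1 ≤ i ∧ i < s1 + n1) := by
    intro i hi
    rw [m1]
    constructor
    · rintro ⟨j, h1, h2, h3⟩
      have := iU hi (by omega) h3
      omega
    · rintro ⟨h1, h2⟩; exact ⟨i, h1, h2, rfl⟩
  have in2 : ∀ {i : ℕ}, i < B.Pl.length → (s(B.Pl.getVert i, B.Pl.getVert (i + 1)) ∈ B.S2.edges ↔
      s2 ≤ i ∧ i < s2 + n2) := by
    intro i hi
    rw [m2]
    constructor
    · rintro ⟨j, h1, h2, h3⟩
      have := iL hi (by omega) h3
      omega
    · rintro ⟨h1, h2⟩; exact ⟨i, h1, h2, rfl⟩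
  have in3 : ∀ {i : ℕ}, i < B.Pl.length → (s(B.Pl.getVert i, B.Pl.getVert (i + 1)) ∈ B.S3.edges ↔
      s3 ≤ i ∧ i < s3 + n3) := by
    intro i hi
    rw [m3]
    constructor
    · rintro ⟨j, h1, h2, h3⟩
      have := iL hi (by omega) h3
      omega
    · rintro ⟨h1, h2⟩; exact ⟨i, h1, h2, rfl⟩
  have inM : ∀ e ∈ B.M.edges, ∃ k, k < B.M.length ∧
      (e ∈ B.S1.edges ↔ s1 ≤ B.Lu.length + k ∧ B.Lu.length + k < s1 + n1) ∧
      (e ∈ B.S2.edges ↔ s2 ≤ B.Ll.length + k ∧ B.Ll.length + k < s2 + n2) ∧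
      (e ∈ B.S3.edges ↔ s3 ≤ B.Ll.length + k ∧ B.Ll.length + k < s3 + n3) := by
    intro e he
    obtain ⟨k, hk, h1, _⟩ := app_Me B.Lu B.M B.Ru he
    refine ⟨k, hk, ?_, ?_, ?_⟩
    · rw [← in1 (by omega)]
      exact iff_of_eq (by rw [h1]; rfl)
    · rw [← in2 (by omega), add_assoc, ← B.fg (by omega), ← B.fg (by omega)]
      exact iff_of_eq (by rw [h1]; rfl)
    · rw [← in3 (by omega), add_assoc, ← B.fg (by omega), ← B.fg (by omega)]
      exact iff_of_eq (by rw [h1]; rfl)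
  obtain ⟨er, her, her'⟩ := B.hC1Ru
  obtain ⟨ir, i1, i2, rfl⟩ := app_Re B.Lu B.M B.Ru her'
  have her := (in1 i2).1 her
  obtain ⟨el, hel, hel'⟩ := B.hC2Ll
  obtain ⟨il, i3, rfl⟩ := app_Le B.Ll B.M B.Rl hel'
  have hel := (in2 (by omega)).1 hel
  obtain ⟨er3, her3, her3'⟩ := B.hC3Rl
  obtain ⟨jr, i4, i5, rfl⟩ := app_Re B.Ll B.M B.Rl her3'
  have her3 := (in3 i5).1 her3
  obtain ⟨e3, he3, he32, he33⟩ := B.hC_ne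
  have he31 := B.hC_sub e3 he3 he32 he33
  obtain ⟨k3, hk3, j31, j32, j33⟩ := inM e3 he3
  rw [j31] at he31
  rw [j32] at he32
  rw [j33] at he33
  obtain ⟨e2, he2, he21, he22, he23⟩ := B.hC1C2
  obtain ⟨k2, hk2, j21, j22, j23⟩ := inM e2 he2
  rw [j21] at he21
  rw [j22] at he22
  rw [j23] at he23
  obtain ⟨e4, he4, he41, he43, he42⟩ := B.hC1C3
  obtain ⟨k4, hk4, j41, j42, j43⟩ := inM e4 he4
  rw [j41] at he41
  rw [j42] at he42
  rw [j43] at he43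
  clear j31 j32 j33 j21 j22 j23 j41 j42 j43
  refine ⟨s1, s1 + n1, s2, s2 + n2, s3, s3 + n3, k2, k3, k4, ir, jr, ⟨by omega, by omega, by omega⟩,
    ⟨by omega, by omega, by omega, by omega⟩, ⟨by omega, by omega, by omega⟩,
    ⟨by omega, by omega, by omega, by omega, by omega⟩, ⟨a1, b1⟩, ⟨a2, b2⟩, ⟨a3, b3⟩, ?_⟩
  intro e he
  obtain ⟨i, h1, h2, h3⟩ := (m2 e).1 he
  exact ⟨i, h1, by omega, h3⟩

end PBC

end extraction


section final

variable {G : SimpleGraph V} {u v w x : V}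

namespace PBC

variable (B : PBC G u v w x)

lemma q_len {a b : V} (q : G.Walk a b) (h : q.edges ≠ []) : 1 ≤ q.length := by
  rw [← SimpleGraph.Walk.length_edges]
  exact List.length_pos_iff.2 h

/-- The common consequences of the nine types. -/
lemma cond (hB : B.IsBC) {s2 : ℕ} (hs2 : s2 < B.Ll.length) (ha2 : B.Pl.getVert s2 = B.a2)
    (hS2 : ∀ e ∈ B.S2.edges, ∃ i, s2 ≤ i ∧ i < B.Pl.length ∧
      e = s(B.Pl.getVert i, B.Pl.getVert (i + 1)))
    {t1 : ℕ} (ht1 : B.Lu.length + B.M.length < t1) (ht1' : t1 ≤ B.Pu.length)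
    (hb1 : B.Pu.getVert t1 = B.b1) :
    (∀ y ∈ B.q2.support, y ≠ B.a2 → y ≠ B.b2 → y ∉ B.Pu.support) ∧
    (∀ y ∈ B.q3.support, y ≠ B.a3 → y ≠ B.b3 → y ∉ B.Pu.support) ∧
    (∀ y ∈ B.q1.support, y ∉ B.q3.support) ∧ (∀ y ∈ B.q2.support, y ∉ B.q3.support) ∧
    ∃ k, k < B.q1.length ∧
      (∀ i, i ≤ k → B.q1.getVert i = B.a1 ∨
        ∃ j, s2 < j ∧ j ≤ B.Ll.length ∧ B.Pl.getVert j = B.q1.getVert i) ∧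
      (∀ i, k < i → i < B.q1.length → B.q1.getVert i ∉ B.Pl.support) := by
  have hlu := B.Pu_len
  have hll := B.Pl_len
  have hn1 := q_len B.q1 B.hq1_ne
  have inj1 := vinj B.hq1path
  have end0 : B.q1.getVert 0 = B.a1 := B.q1.getVert_zero
  have end1 : B.q1.getVert B.q1.length = B.b1 := B.q1.getVert_length
  have memq : ∀ i, B.q1.getVert i ∈ B.q1.support := fun i => B.q1.getVert_mem_support i
  have MPu : ∀ j, B.Ll.length ≤ j → j ≤ B.Ll.length + B.M.length →
      B.Pl.getVert j ∈ B.Pu.support := by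
    intro j h1 h2
    obtain ⟨t, rfl⟩ := Nat.exists_eq_add_of_le h1
    rw [← B.fg (by omega)]
    exact B.Pu.getVert_mem_support _
  have off : ∀ {a b : V} (q : G.Walk a b), B.AvoidsUpperOuter q →
      (∀ y ∈ q.support, y ∈ B.Pl.support → y = a ∨ y = b) →
      ∀ y ∈ q.support, y ≠ a → y ≠ b → y ∉ B.Pu.support := by
    intro a b q hq hcl y hy h1 h2 hyU
    obtain ⟨i, hi, rfl⟩ := (mem_support_iff' _ _).1 hyU
    rcases Nat.lt_or_ge i B.Lu.length with h | h
    · exact (hq _ hy).1 ((app_Ls B.Lu B.M B.Ru _).2 ⟨i, h.le, rfl⟩)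
    rcases Nat.lt_or_ge (B.Lu.length + B.M.length) i with h' | h'
    · exact (hq _ hy).2 (app_Rs B.Lu B.M B.Ru h'.le hi)
    · obtain ⟨t, rfl⟩ := Nat.exists_eq_add_of_le h
      have : B.Pu.getVert (B.Lu.length + t) ∈ B.Pl.support := by
        rw [B.fg (by omega)]; exact B.Pl.getVert_mem_support _
      rcases hcl _ hy this with h3 | h3
      · exact h1 h3
      · exact h2 h3
  have intern : B.InternDisj B.q1 → ∃ k, k < B.q1.length ∧
      (∀ i, i ≤ k → B.q1.getVert i = B.a1 ∨
        ∃ j, s2 < j ∧ j ≤ B.Ll.length ∧ B.Pl.getVert j = B.q1.getVert i) ∧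
      (∀ i, k < i → i < B.q1.length → B.q1.getVert i ∉ B.Pl.support) := by
    intro h
    refine ⟨0, by omega, ?_, ?_⟩
    · intro i hi
      obtain rfl : i = 0 := by omega
      exact Or.inl end0
    · intro i h1 h2
      refine (h _ (memq i) ?_ ?_).2
      · intro h3
        have := inj1 _ 0 h2.le (by omega) (h3.trans end0.symm)
        omega
      · intro h3
        have := inj1 _ _ h2.le le_rfl (h3.trans end1.symm)
        omega
  have trav : B.LlTraverse → ∃ k, k < B.q1.length ∧
      (∀ i, i ≤ k → B.q1.getVert i = B.a1 ∨
        ∃ j, s2 < j ∧ j ≤ B.Ll.length ∧ B.Pl.getVert j = B.q1.getVert i) ∧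
      (∀ i, k < i → i < B.q1.length → B.q1.getVert i ∉ B.Pl.support) := by
    rintro ⟨hRl, ha2q, y, α, β, hq, hy, hα, hβ⟩
    have hlen : B.q1.length = α.length + β.length := by
      rw [hq, SimpleGraph.Walk.length_append]
    have hky : B.q1.getVert α.length = y := by
      rw [hq, SimpleGraph.Walk.getVert_append]; simp
    have hαv : ∀ i, i ≤ α.length → α.getVert i = B.q1.getVert i := by
      intro i hi
      rw [hq, SimpleGraph.Walk.getVert_append]
      split_ifs with h
      · rfl
      · obtain rfl : i = α.length := by omega
        simp
    have hk : α.length < B.q1.length := by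
      rcases Nat.lt_or_ge α.length B.q1.length with h | h
      · exact h
      · exfalso
        have h1 : α.length = B.q1.length := by omega
        rw [h1, end1] at hky
        obtain ⟨j, hj, h2⟩ := (app_Ls B.Ll B.M B.Rl _).1 hy
        obtain ⟨t, h3, h4, h5⟩ := B.meet ht1' (show j ≤ _ by omega)
          (by rw [hb1, hky, ← h2]; rfl)
        omega
    have onPu : ∀ i, i < B.q1.length → B.q1.getVert i ∈ B.Pu.support →
        B.q1.getVert i = B.a1 := by
      intro i hi h
      rcases B.hq1closes _ (memq i) h with h1 | h1
      · exact h1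
      · have := inj1 _ _ hi.le le_rfl (h1.trans end1.symm)
        omega
    refine ⟨α.length, hk, ?_, ?_⟩
    · intro i hi
      by_cases hU : B.q1.getVert i ∈ B.Pu.support
      · exact Or.inl (onPu i (by omega) hU)
      by_cases h0 : α.length = 0
      · left
        obtain rfl : i = 0 := by omega
        exact end0
      right
      have : ∃ t, t < α.length ∧ (i = t ∨ i = t + 1) := by
        rcases Nat.lt_or_ge i α.length with h | h
        · exact ⟨i, h, Or.inl rfl⟩
        · exact ⟨i - 1, by omega, by omega⟩
      obtain ⟨t, ht, hit⟩ := this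
      obtain ⟨r, hr1, hr2, hr3⟩ := hS2 _ (hα _ ((mem_edges_iff α _).2 ⟨t, ht, rfl⟩))
      rw [hαv t ht.le, hαv (t + 1) ht] at hr3
      have hmem : B.q1.getVert i ∈ s(B.q1.getVert t, B.q1.getVert (t + 1)) := by
        rcases hit with rfl | rfl <;> simp
      rw [hr3, Sym2.mem_iff] at hmem
      have : ∃ j, s2 ≤ j ∧ j ≤ B.Pl.length ∧ B.Pl.getVert j = B.q1.getVert i := by
        rcases hmem with h | h
        · exact ⟨r, hr1, hr2.le, h.symm⟩
        · exact ⟨r + 1, by omega, hr2, h.symm⟩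
      obtain ⟨j, h1, h2, h3⟩ := this
      refine ⟨j, ?_, ?_, h3⟩
      · rcases Nat.lt_or_ge s2 j with h | h
        · exact h
        · obtain rfl : j = s2 := by omega
          exact absurd (by rw [← ha2, h3]; exact memq i) ha2q
      · by_contra hj
        rcases Nat.lt_or_ge (B.Ll.length + B.M.length) j with h | h
        · exact hRl _ (memq i) (h3 ▸ app_Rs B.Ll B.M B.Rl h.le h2)
        · exact hU (h3 ▸ MPu j (by omega) h)
    · intro i h1 h2 h3
      obtain ⟨j, hj, h4⟩ := (mem_support_iff' _ _).1 h3
      rcases Nat.lt_or_ge (B.Ll.length + B.M.length) j with h | h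
      · exact hRl _ (memq i) (h4 ▸ app_Rs B.Ll B.M B.Rl h.le hj)
      rcases Nat.lt_or_ge j B.Ll.length with h' | h'
      · have h5 : B.q1.getVert i ∈ B.Ll.support :=
          (app_Ls B.Ll B.M B.Rl _).2 ⟨j, h'.le, h4⟩
        have h6 : B.q1.getVert i ∈ β.support := by
          rw [mem_support_iff']
          refine ⟨i - α.length, by omega, ?_⟩
          rw [hq, SimpleGraph.Walk.getVert_append, if_neg (by omega)]
        have h7 := hβ _ h6 h5
        rw [← hky] at h7
        have := inj1 _ _ h2.le hk.le h7
        omega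
      · have h8 := onPu i h2 (h4 ▸ MPu j h' h)
        have := inj1 _ 0 h2.le (by omega) (h8.trans end0.symm)
        omega
  rcases hB with h | h | h | h
  · obtain ⟨_, h13, h23, i1, i2, i3⟩ := h
    exact ⟨fun y h a b => (i2 y h a b).1, fun y h a b => (i3 y h a b).1, h13, h23, intern i1⟩
  · obtain ⟨h31, h32, _, _, i1, i2, i3⟩ := h
    exact ⟨fun y h a b => (i2 y h a b).1, fun y h a b => (i3 y h a b).1,
      fun y h h' => h31 y h' h, fun y h h' => h32 y h' h, intern i1⟩
  · obtain ⟨_, _, _, h13, h23, o2, o3, tr⟩ := h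
    exact ⟨off _ o2 B.hq2closes, off _ o3 B.hq3closes, h13, h23, trav tr⟩
  · obtain ⟨_, _, h31, h32, _, _, o2, o3, tr⟩ := h
    exact ⟨off _ o2 B.hq2closes, off _ o3 B.hq3closes,
      fun y h h' => h31 y h' h, fun y h h' => h32 y h' h, trav tr⟩

lemma core [Fintype V] (hB : B.IsBC) :
    ∃ c EU EL E1 E2 E3, Core G u v w x c EU EL E1 E2 E3 := by
  obtain ⟨s1, t1, s2, t2, s3, t3, k2, k3, k4, ir, jr, ⟨g1, g2, g3⟩, ⟨g4, g5, g6, g7⟩,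
    ⟨g8, g9, g10⟩, ⟨g11, g12, g13, g14, g15⟩, ⟨a1, b1⟩, ⟨a2, b2⟩, ⟨a3, b3⟩, hS2⟩ := B.nums
  obtain ⟨o2, o3, h13, h23, k, hk, hlo, hmid⟩ :=
    B.cond hB g8 a2 hS2 (show B.Lu.length + B.M.length < t1 by omega) g7 b1
  have hlu := B.Pu_len
  have hll := B.Pl_len
  have inside : ∀ {a b : V} (q : G.Walk a b), q.IsPath → ∀ i, 0 < i → i < q.length →
      q.getVert i ≠ a ∧ q.getVert i ≠ b := by
    intro a b q hq i h0 h1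
    constructor
    · intro h
      have := vinj hq i 0 h1.le (by omega) (by rw [h, q.getVert_zero])
      omega
    · intro h
      have := vinj hq i _ h1.le le_rfl (by rw [h, q.getVert_length])
      omega
  have nsup : ∀ {a b : V} (q : G.Walk a b) (y : V), y ∉ q.support →
      ∀ j, j ≤ q.length → q.getVert j ≠ y := by
    intro a b q y hy j _ h
    exact hy (h ▸ q.getVert_mem_support j)
  let C : Cfg V :=
    { f := B.Pu.getVert
      g := B.Pl.getVert
      p1 := B.q1.getVert
      p2 := B.q2.getVert
      p3 := B.q3.getVert
      nu := B.Pu.length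
      nl := B.Pl.length
      lu := B.Lu.length
      ll := B.Ll.length
      m := B.M.length
      n1 := B.q1.length
      n2 := B.q2.length
      n3 := B.q3.length
      k := k
      k2 := k2
      k3 := k3
      k4 := k4
      jl := s2
      ir := ir
      jr := jr
      h23 := g1
      h34 := g2
      h4m := g3
      hjl := g8
      hir := g5
      hiru := by omega
      hjr := g13
      hjrl := by omega
      hk := hk
      hn2 := q_len _ B.hq2_ne
      hn3 := q_len _ B.hq3_ne
      fg := fun t ht => B.fg ht
      finj := vinj (P := B.Pu) B.hPu
      ginj := vinj (P := B.Pl) B.hPl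
      meet := fun i j hi hj h => B.meet hi hj h
      p1lo := fun i hi => (hlo i hi).imp (fun h => ⟨s1, g4, by rw [h, a1]⟩) id
      p1mid := fun i h1 h2 => by
        obtain ⟨e1, e2⟩ := inside B.q1 B.hq1path i (by omega) h2
        have hm := B.q1.getVert_mem_support i
        refine ⟨nsup _ _ ?_, nsup _ _ (hmid i h1 h2), nsup _ _ (h13 _ hm)⟩
        intro h
        rcases B.hq1closes _ hm h with h' | h'
        · exact e1 h'
        · exact e2 h'
      p1hi := ⟨t1, g6, g7, by rw [b1, B.q1.getVert_length]⟩
      p2lo := by rw [a2, B.q2.getVert_zero]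
      p2mid := fun i h1 h2 => by
        obtain ⟨e1, e2⟩ := inside B.q2 B.hq2path i h1 h2
        have hm := B.q2.getVert_mem_support i
        refine ⟨nsup _ _ (o2 _ hm e1 e2), nsup _ _ ?_, nsup _ _ (h23 _ hm)⟩
        intro h
        rcases B.hq2closes _ hm h with h' | h'
        · exact e1 h'
        · exact e2 h'
      p2hi := ⟨t2, g9, g10, by rw [b2, B.q2.getVert_length]⟩
      p3lo := ⟨s3, g11, g12, by rw [a3, B.q3.getVert_zero]⟩
      p3mid := fun i h1 h2 => by
        obtain ⟨e1, e2⟩ := inside B.q3 B.hq3path i h1 h2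
        have hm := B.q3.getVert_mem_support i
        refine ⟨nsup _ _ (o3 _ hm e1 e2), nsup _ _ ?_⟩
        intro h
        rcases B.hq3closes _ hm h with h' | h'
        · exact e1 h'
        · exact e2 h'
      p3hi := ⟨t3, g14, g15, by rw [b3, B.q3.getVert_length]⟩ }
  obtain ⟨E1, hE1, hE1'⟩ := dev a1 b1 B.q1
  obtain ⟨E2, hE2, hE2'⟩ := dev a2 b2 B.q2
  obtain ⟨E3, hE3, hE3'⟩ := dev a3 b3 B.q3
  have mem : ∀ {a b : V} (q : G.Walk a b) (e : Sym2 V), e ∈ q.edges.toFinset ↔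
      ∃ i, i < q.length ∧ e = s(q.getVert i, q.getVert (i + 1)) := by
    intro a b q e
    rw [List.mem_toFinset, mem_edges_iff]
  obtain ⟨c, hc⟩ := C.core (G := G) (u := u) (v := v) (w := w) (x := x)
    (EU := B.Pu.edges.toFinset) (EL := B.Pl.edges.toFinset) (Q1 := B.q1.edges.toFinset)
    (Q2 := B.q2.edges.toFinset) (Q3 := B.q3.edges.toFinset) (E1 := E1) (E2 := E2) (E3 := E3)
    ⟨B.Pu, B.hPu, rfl⟩ ⟨B.Pl, B.hPl, rfl⟩ hE1 hE2 hE3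
    (by
      have h := B.hforest
      convert h using 2
      ext e
      simp only [Finset.coe_union, Set.mem_union, Finset.mem_coe, List.mem_toFinset,
        Set.mem_ofPred_eq]
      rfl)
    B.Pu.getVert_zero B.Pu.getVert_length B.Pl.getVert_zero B.Pl.getVert_length
    (mem _) (mem _) (mem _) (mem _) (mem _)
    (by
      intro e he
      rw [List.mem_toFinset]
      refine (hE1' e he).imp ?_ id
      rintro ⟨i, h1, h2, h3⟩
      refine ⟨i, ?_, h2, h3⟩
      change i < B.Lu.length + k2 ∨ ir < i
      omega)
    (by
      intro e he
      rw [List.mem_toFinset]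
      refine (hE2' e he).imp ?_ id
      rintro ⟨i, h1, h2, h3⟩
      refine ⟨i, ?_, h2, h3⟩
      change i < s2 ∨ B.Ll.length + k3 < i
      omega)
    (by
      intro e he
      rw [List.mem_toFinset]
      refine (hE3' e he).imp ?_ id
      rintro ⟨i, h1, h2, h3⟩
      refine ⟨i, ?_, h2, h3⟩
      change i < B.Ll.length + k3 ∨ jr < i
      omega)
  exact ⟨c, _, _, _, _, _, hc⟩

end PBC

lemma concl_of_contains [Fintype V] (G : SimpleGraph V) (s₁ t₁ s₂ t₂ : V)
    (hBC : ContainsBC G s₁ t₁ s₂ t₂) : Concl G s₁ t₁ s₂ t₂ := by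
  rcases hBC with ⟨B, h⟩ | ⟨B, h⟩ | ⟨B, h⟩ | ⟨B, h⟩ | ⟨B, h⟩ | ⟨B, h⟩ | ⟨B, h⟩ | ⟨B, h⟩ <;>
    obtain ⟨c, EU, EL, E1, E2, E3, hc⟩ := B.core h
  · exact hc.concl
  · exact hc.symm2.concl
  · exact hc.symm1.concl
  · exact hc.symm1.symm2.concl
  · exact hc.concl'
  · exact hc.symm2.concl'
  · exact hc.symm1.concl'
  · exact hc.symm1.symm2.concl'

end final

/-- If `(G,(s₁,t₁),(s₂,t₂))` contains a subgraph which is a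
bad configuration, then there is a nonnegative cost function for which the
optimal Steiner forest is unique and not enforceable; consequently
`(G,(s₁,t₁),(s₂,t₂))` is neither efficient nor strongly efficient. -/
theorem bc_implies_not_efficient [Fintype V] (G : SimpleGraph V) (s₁ t₁ s₂ t₂ : V)
    (hBC : ContainsBC G s₁ t₁ s₂ t₂) :
    (∃ c : Sym2 V → ℝ, (∀ e, 0 ≤ c e) ∧
      ∃ F, IsOptimalSteinerForest G s₁ t₁ s₂ t₂ c F ∧
        (∀ F', IsOptimalSteinerForest G s₁ t₁ s₂ t₂ c F' → F' = F) ∧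
        ¬ Enforceable G s₁ t₁ s₂ t₂ c F) ∧
    ¬ Efficient G s₁ t₁ s₂ t₂ ∧ ¬ StronglyEfficient G s₁ t₁ s₂ t₂ := by
  have hC : Concl G s₁ t₁ s₂ t₂ := concl_of_contains G s₁ t₁ s₂ t₂ hBC
  refine ⟨hC, ?_, ?_⟩
  · intro hE
    obtain ⟨c, hc, F, hF, hu, hn⟩ := hC
    obtain ⟨F', hF', he⟩ := hE c hc
    rw [hu F' hF'] at he
    exact hn he
  · intro hE
    obtain ⟨c, hc, F, hF, hu, hn⟩ := hC
    exact hn (hE c hc F hF)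

end NDG
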